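/- arXiv:1910.05854 — 3 statements merged into one kernel-verified Lean document; each statement's English description precedes it below -/
import Mathlib

section
/- For every fixed s > 0, the ratio I(s,t)/(U(s) U(t)) tends to 1 as t → ∞, where I(s,t) = ∫₀^s U(t−τ) u(τ) dτ; that is, I(s,t) is asymptotically equivalent to U(s)U(t) as t → ∞. -/
open Real MeasureTheory Filter Topology

/-- Two-parameter Mittag-Leffler function `E_{a,b}(x)`. -/
noncomputable def ML (a b x : ℝ) : ℝ :=
  ∑' k : ℕ, x ^ k / Real.Gamma ((k : ℝ) * a + b)

/-- Second-order (three-parameter, `γ = 2`) Mittag-Leffler function `E²_{a,b}(x)`. -/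
noncomputable def ML2 (a b x : ℝ) : ℝ :=
  ∑' k : ℕ, ((k : ℝ) + 1) * x ^ k / Real.Gamma ((k : ℝ) * a + b)

/-- Renewal function `U(t)` of the inverse mixed stable subordinator. -/
noncomputable def Ufun (a1 a2 C1 C2 t : ℝ) : ℝ :=
  t ^ a1 / C1 * ML (a1 - a2) (a1 + 1) (-C2 * t ^ (a1 - a2) / C1)

/-- Renewal density `u(t)` of the inverse mixed stable subordinator. -/
noncomputable def ufun (a1 a2 C1 C2 t : ℝ) : ℝ :=
  t ^ (a1 - 1) / C1 * ML (a1 - a2) a1 (-C2 * t ^ (a1 - a2) / C1)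

/-- Covariance function of the inverse mixed stable subordinator. -/
noncomputable def CovY (a1 a2 C1 C2 s t : ℝ) : ℝ :=
  (∫ τ in (0:ℝ)..(min s t),
      (Ufun a1 a2 C1 C2 (s - τ) + Ufun a1 a2 C1 C2 (t - τ)) * ufun a1 a2 C1 C2 τ)
    - Ufun a1 a2 C1 C2 s * Ufun a1 a2 C1 C2 t

/-- Variance function of the inverse mixed stable subordinator. -/
noncomputable def VarY (a1 a2 C1 C2 t : ℝ) : ℝ := CovY a1 a2 C1 C2 t t

/-- The integral `I(s,t) = ∫₀^s U(t-τ) u(τ) dτ`. -/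
noncomputable def Ifun (a1 a2 C1 C2 s t : ℝ) : ℝ :=
  ∫ τ in (0:ℝ)..s, Ufun a1 a2 C1 C2 (t - τ) * ufun a1 a2 C1 C2 τ

/-- The constant `K(s)`. -/
noncomputable def Kfun (a1 a2 C1 C2 s : ℝ) : ℝ :=
  s ^ (a1 + 1) / (C1 * C2 * Real.Gamma a2) *
    ∑' k : ℕ, ((k : ℝ) * (a1 - a2) + a1) * (-C2 * s ^ (a1 - a2) / C1) ^ k /
      Real.Gamma ((k : ℝ) * (a1 - a2) + a1 + 2)

/-- Covariance function of the mixed fractional Poisson process. -/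
noncomputable def CovN (a1 a2 C1 C2 lam s t : ℝ) : ℝ :=
  lam * Ufun a1 a2 C1 C2 (min s t) + lam ^ 2 * CovY a1 a2 C1 C2 s t

/-- Variance function of the mixed fractional Poisson process. -/
noncomputable def VarN (a1 a2 C1 C2 lam t : ℝ) : ℝ :=
  lam * Ufun a1 a2 C1 C2 t + lam ^ 2 * VarY a1 a2 C1 C2 t

/-- Correlation function of the inverse mixed stable subordinator. -/
noncomputable def CorrY (a1 a2 C1 C2 s t : ℝ) : ℝ :=
  CovY a1 a2 C1 C2 s t /
    (Real.sqrt (VarY a1 a2 C1 C2 s) * Real.sqrt (VarY a1 a2 C1 C2 t))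

/-- Correlation function of the mixed fractional Poisson process. -/
noncomputable def CorrN (a1 a2 C1 C2 lam s t : ℝ) : ℝ :=
  CovN a1 a2 C1 C2 lam s t /
    (Real.sqrt (VarN a1 a2 C1 C2 lam s) * Real.sqrt (VarN a1 a2 C1 C2 lam t))

/-- Covariance function of the mixed fractional Poissonian noise. -/
noncomputable def CovZ (a1 a2 C1 C2 lam δ s t : ℝ) : ℝ :=
  CovN a1 a2 C1 C2 lam (s + δ) (t + δ) + CovN a1 a2 C1 C2 lam s t
    - CovN a1 a2 C1 C2 lam (s + δ) t - CovN a1 a2 C1 C2 lam s (t + δ)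

/-- Variance function of the mixed fractional Poissonian noise. -/
noncomputable def VarZ (a1 a2 C1 C2 lam δ t : ℝ) : ℝ := CovZ a1 a2 C1 C2 lam δ t t

/-- Correlation function of the mixed fractional Poissonian noise. -/
noncomputable def CorrZ (a1 a2 C1 C2 lam δ s t : ℝ) : ℝ :=
  CovZ a1 a2 C1 C2 lam δ s t /
    (Real.sqrt (VarZ a1 a2 C1 C2 lam δ s) * Real.sqrt (VarZ a1 a2 C1 C2 lam δ t))

/-- Incomplete Beta function `B(a, b; x)`. -/
noncomputable def Binc (a b x : ℝ) : ℝ :=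
  ∫ y in (0:ℝ)..x, y ^ (a - 1) * (1 - y) ^ (b - 1)

/-- The Beta integral on `[0, t]`, in terms of Gamma functions. -/
theorem integral_rpow_mul_rpow_eq_Gamma {b c t : ℝ} (hb : 0 < b) (hc : 0 < c) (ht : 0 < t) :
    ∫ τ in (0:ℝ)..t, τ ^ (b - 1) * (t - τ) ^ (c - 1) =
      t ^ (b + c - 1) * (Gamma b * Gamma c / Gamma (b + c)) := by
  have h := Complex.betaIntegral_scaled (b : ℂ) (c : ℂ) ht
  rw [Complex.betaIntegral_eq_Gamma_mul_div _ _ (by simpa) (by simpa)] at h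
  have hcongr : ∫ x in (0:ℝ)..t, (x : ℂ) ^ ((b : ℂ) - 1) * ((t : ℂ) - x) ^ ((c : ℂ) - 1) =
      ∫ x in (0:ℝ)..t, ((x ^ (b - 1) * (t - x) ^ (c - 1) : ℝ) : ℂ) := by
    refine intervalIntegral.integral_congr fun x hx => ?_
    rw [Set.uIcc_of_le ht.le] at hx
    push_cast [Complex.ofReal_cpow hx.1, Complex.ofReal_cpow (sub_nonneg.2 hx.2)]
    rfl
  rw [hcongr, intervalIntegral.integral_ofReal, ← Complex.ofReal_add, Complex.Gamma_ofReal,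
    Complex.Gamma_ofReal, Complex.Gamma_ofReal] at h
  apply Complex.ofReal_injective
  rw [h]
  push_cast [Complex.ofReal_cpow ht.le]
  rfl

theorem intervalIntegrable_rpow_mul_rpow {b c t : ℝ} (hb : 0 < b) (hc : 0 < c) (ht : 0 < t) :
    IntervalIntegrable (fun τ : ℝ => τ ^ (b - 1) * (t - τ) ^ (c - 1)) volume 0 t := by
  refine intervalIntegral.intervalIntegrable_of_integral_ne_zero ?_
  rw [integral_rpow_mul_rpow_eq_Gamma hb hc ht]
  have := Gamma_pos_of_pos hb
  have := Gamma_pos_of_pos hc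
  have := Gamma_pos_of_pos (add_pos hb hc)
  positivity

theorem rpow_mul_exp_neg_le_Gamma {R y : ℝ} (hR : 0 < R) (hy : 1 ≤ y) :
    R ^ (y - 1) * exp (-R) ≤ Gamma y := by
  have hy0 : 0 < y := by linarith
  have hint := GammaIntegral_convergent hy0
  have hsub : Set.Ioi R ⊆ Set.Ioi 0 := Set.Ioi_subset_Ioi hR.le
  rw [Gamma_eq_integral hy0, ← integral_exp_neg_Ioi R, ← integral_const_mul]
  calc ∫ x in Set.Ioi R, R ^ (y - 1) * exp (-x)
      ≤ ∫ x in Set.Ioi R, exp (-x) * x ^ (y - 1) := by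
        refine setIntegral_mono_on ((integrableOn_exp_neg_Ioi R).const_mul _)
          (hint.mono_set hsub) measurableSet_Ioi fun x hx => ?_
        rw [mul_comm]
        gcongr
        exact le_of_lt hx
    _ ≤ ∫ x in Set.Ioi 0, exp (-x) * x ^ (y - 1) := by
        refine setIntegral_mono_set hint ?_ hsub.eventuallyLE
        filter_upwards [ae_restrict_mem measurableSet_Ioi] with x hx
        have : 0 < x := hx
        simp only [Pi.zero_apply]
        positivity

/-- The Mittag-Leffler series converges absolutely. -/
theorem summable_mittagLeffler {a b : ℝ} (ha : 0 < a) (hb : 0 < b) (x : ℝ) :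
    Summable fun k : ℕ => x ^ k / Gamma (k * a + b) := by
  obtain ⟨R, hR, hRx⟩ : ∃ R : ℝ, 0 < R ∧ 2 * |x| ≤ R ^ a :=
    ((eventually_gt_atTop 0).and
      ((tendsto_rpow_atTop ha).eventually_ge_atTop (2 * |x|))).exists
  have hbound : ∀ᶠ k : ℕ in atTop,
      ‖x ^ k / Gamma (k * a + b)‖ ≤ R ^ (1 - b) * exp R * (1 / 2) ^ k := by
    have hlarge : Tendsto (fun k : ℕ => (k : ℝ) * a) atTop atTop :=
      tendsto_natCast_atTop_atTop.atTop_mul_const ha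
    filter_upwards [hlarge.eventually_ge_atTop 1] with k hk
    have hG := rpow_mul_exp_neg_le_Gamma hR (show 1 ≤ k * a + b by linarith)
    have hGpos : 0 < Gamma (k * a + b) := Gamma_pos_of_pos (by linarith)
    rw [norm_div, norm_pow, norm_eq_abs, norm_of_nonneg hGpos.le, div_le_iff₀ hGpos]
    calc |x| ^ k ≤ (1 / 2 * R ^ a) ^ k := by gcongr; linarith
      _ = R ^ (1 - b) * exp R * (1 / 2) ^ k * (R ^ (k * a + b - 1) * exp (-R)) := by
        have h1 : R ^ (1 - b) * R ^ (k * a + b - 1) = (R ^ a) ^ k := by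
          rw [← rpow_add hR, ← rpow_mul_natCast hR.le]; ring_nf
        have h2 : exp R * exp (-R) = 1 := by rw [← exp_add]; simp
        rw [mul_pow, ← h1]
        linear_combination (-(1 / 2) ^ k * (R ^ (1 - b) * R ^ (k * a + b - 1))) * h2
      _ ≤ _ := by gcongr
  exact .of_norm_bounded_eventually_nat
    ((summable_geometric_of_lt_one (by norm_num) (by norm_num)).mul_left _) hbound

theorem continuous_ML {a b : ℝ} (ha : 0 < a) (hb : 0 < b) : Continuous (ML a b) := by
  refine continuous_iff_continuousAt.2 fun x => ?_
  have hcont : ContinuousOn (ML a b) (Set.Ioo (-(|x| + 1)) (|x| + 1)) := by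
    refine continuousOn_tsum (fun k => by fun_prop) (summable_mittagLeffler ha hb (|x| + 1))
      fun k y hy => ?_
    have hG : 0 < Gamma (k * a + b) := Gamma_pos_of_pos (by positivity)
    rw [norm_div, norm_pow, norm_eq_abs, norm_of_nonneg hG.le]
    gcongr
    exact (abs_lt.2 hy).le
  exact hcont.continuousAt
    (Ioo_mem_nhds (by linarith [neg_abs_le x]) (by linarith [le_abs_self x]))

theorem ML_zero (a b : ℝ) : ML a b 0 = 1 / Gamma b := by
  rw [ML, tsum_eq_single 0 fun k hk => by simp [hk]]
  simp

theorem ML_eq_add {a b : ℝ} (ha : 0 < a) (hb : 0 < b) (x : ℝ) :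
    ML a b x = 1 / Gamma b + x * ML a (b + a) x := by
  rw [ML, (summable_mittagLeffler ha hb x).tsum_eq_zero_add, ML, ← tsum_mul_left]
  congr 1
  · simp
  · refine tsum_congr fun k => ?_
    push_cast
    rw [show ((k : ℝ) + 1) * a + b = k * a + (b + a) by ring]
    ring

/-- Riemann–Liouville fractional integral of order `c` of `τ ↦ τ ^ (b - 1) * E_{a,b}(x τ ^ a)`. -/
theorem integral_rpow_mul_ML {a b c t : ℝ} (ha : 0 < a) (hb : 0 < b) (hc : 0 < c) (ht : 0 < t)
    (x : ℝ) :
    ∫ τ in (0:ℝ)..t, (t - τ) ^ (c - 1) * (τ ^ (b - 1) * ML a b (x * τ ^ a)) =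
      Gamma c * (t ^ (b + c - 1) * ML a (b + c) (x * t ^ a)) := by
  have hbk (k : ℕ) : 0 < k * a + b := by positivity
  have hG (k : ℕ) : 0 < Gamma (k * a + b) := Gamma_pos_of_pos (hbk k)
  let F (x : ℝ) (k : ℕ) (τ : ℝ) : ℝ :=
    x ^ k / Gamma (k * a + b) * (τ ^ (k * a + b - 1) * (t - τ) ^ (c - 1))
  have hF_int (x : ℝ) (k : ℕ) : Integrable (F x k) (volume.restrict (Set.Ioc 0 t)) :=
    ((intervalIntegrable_iff_integrableOn_Ioc_of_le ht.le).1
      (intervalIntegrable_rpow_mul_rpow (hbk k) hc ht)).const_mul _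
  have hF_val (x : ℝ) (k : ℕ) : ∫ τ in Set.Ioc 0 t, F x k τ =
      Gamma c * t ^ (b + c - 1) * ((x * t ^ a) ^ k / Gamma (k * a + (b + c))) := by
    rw [integral_const_mul, ← intervalIntegral.integral_of_le ht.le,
      integral_rpow_mul_rpow_eq_Gamma (hbk k) hc ht, mul_pow, ← rpow_mul_natCast ht.le,
      show (k : ℝ) * a + b + c - 1 = (b + c - 1) + a * k by ring, rpow_add ht, add_assoc]
    field_simp [(hG k).ne']
  have hF_norm (k : ℕ) : ∫ τ in Set.Ioc 0 t, ‖F x k τ‖ = ∫ τ in Set.Ioc 0 t, F |x| k τ := by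
    refine setIntegral_congr_fun measurableSet_Ioc fun τ hτ => ?_
    have h1 : 0 ≤ τ ^ (k * a + b - 1) := rpow_nonneg hτ.1.le _
    have h2 : 0 ≤ (t - τ) ^ (c - 1) := rpow_nonneg (sub_nonneg.2 hτ.2) _
    simp only [F, norm_mul, norm_div, norm_pow, norm_eq_abs, abs_of_pos (hG k), abs_of_nonneg h1,
      abs_of_nonneg h2]
  have hsum := hasSum_integral_of_summable_integral_norm (hF_int x) (by
    simp_rw [hF_norm, hF_val]
    exact (summable_mittagLeffler ha (by positivity) _).mul_left _)
  simp_rw [hF_val] at hsum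
  have hRHS := hsum.tsum_eq
  rw [tsum_mul_left] at hRHS
  rw [intervalIntegral.integral_of_le ht.le, ← mul_assoc, ML, hRHS]
  refine setIntegral_congr_fun measurableSet_Ioc fun τ hτ => ?_
  simp only [F, ML]
  rw [← mul_assoc, ← tsum_mul_left]
  refine tsum_congr fun k => ?_
  rw [mul_pow, ← rpow_mul_natCast hτ.1.le,
    show (k : ℝ) * a + b - 1 = (b - 1) + a * k by ring, rpow_add hτ.1]
  ring

/-- A solution of `u(t) + m ∫₀ᵗ (t - τ) ^ (a - 1) u(τ) dτ = c t ^ (b - 1)`, `0 < a ≤ b`, `a ≤ 1`,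
which is positive near the origin is positive on `(0, ∞)`. -/
theorem pos_of_volterra {a b c m : ℝ} {u : ℝ → ℝ} (ha : 0 < a) (ha1 : a ≤ 1) (hab : a ≤ b)
    (hc : 0 ≤ c) (hm : 0 < m) (hu : ContinuousOn u (Set.Ioi 0))
    (hu0 : ∀ᶠ t in 𝓝[>] 0, 0 < u t)
    (hint : ∀ t, 0 < t → IntervalIntegrable (fun τ => (t - τ) ^ (a - 1) * u τ) volume 0 t)
    (heq : ∀ t, 0 < t →
      u t + m * ∫ τ in (0:ℝ)..t, (t - τ) ^ (a - 1) * u τ = c * t ^ (b - 1))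
    {t : ℝ} (ht : 0 < t) : 0 < u t := by
  by_contra! htneg
  obtain ⟨ε, hε, hεu⟩ := (mem_nhdsGT_iff_exists_Ioo_subset.1 hu0 :)
  replace hε : 0 < ε := hε
  -- the first point where `u` fails to be positive
  obtain ⟨T, hT, hTu, hpos⟩ : ∃ T, 0 < T ∧ u T ≤ 0 ∧ ∀ τ, 0 < τ → τ < T → 0 < u τ := by
    have hεt : ε ≤ t := by
      by_contra! h
      exact htneg.not_gt (hεu ⟨ht, h⟩)
    let S := Set.Icc ε t ∩ u ⁻¹' Set.Iic 0
    have hS : IsCompact S :=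
      isCompact_Icc.of_isClosed_subset
        ((hu.mono fun x hx => hε.trans_le hx.1).preimage_isClosed_of_isClosed isClosed_Icc
          isClosed_Iic) Set.inter_subset_left
    obtain ⟨T, hTS, hTmin⟩ := hS.exists_isLeast ⟨t, ⟨hεt, le_rfl⟩, htneg⟩
    refine ⟨T, hε.trans_le hTS.1.1, hTS.2, fun τ hτ hτT => ?_⟩
    by_contra! h
    rcases lt_or_ge τ ε with h' | h'
    · exact h.not_gt (hεu ⟨hτ, h'⟩)
    · exact hτT.not_ge (hTmin ⟨⟨h', hτT.le.trans hTS.1.2⟩, h⟩)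
  obtain ⟨δ, hδ, hδT, hδm⟩ : ∃ δ : ℝ, 0 < δ ∧ δ ≤ T / 2 ∧ m * (δ ^ a / a) < 1 / 2 := by
    have hlim : Tendsto (fun δ : ℝ => m * (δ ^ a / a)) (𝓝[>] 0) (𝓝 0) := by
      have : Tendsto (fun δ : ℝ => m * (δ ^ a / a)) (𝓝 0) (𝓝 (m * (0 ^ a / a))) :=
        (((continuousAt_rpow_const 0 a (.inr ha.le)).tendsto.div_const a).const_mul m)
      rw [zero_rpow ha.ne', zero_div, mul_zero] at this
      exact this.mono_left nhdsWithin_le_nhds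
    obtain ⟨δ, h, h'⟩ := ((hlim.eventually_lt_const (by norm_num : (0:ℝ) < 1 / 2)).and
      (Ioc_mem_nhdsGT (half_pos hT))).exists
    exact ⟨δ, h'.1, h'.2, h⟩
  obtain ⟨r, hr, hrmax⟩ := (isCompact_Icc (a := T - δ) (b := T)).exists_isMaxOn
    ⟨T, by linarith, le_rfl⟩ (hu.mono fun x hx => by
      have := hx.1
      simp only [Set.mem_Ioi]
      linarith)
  have hur : 0 < u r := (hpos (T - δ) (by linarith) (by linarith)).trans_le
    (hrmax ⟨le_rfl, by linarith⟩)
  have hr0 : 0 < r := by linarith [hr.1]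
  have hrT : r < T := hr.2.lt_of_ne (by rintro rfl; exact hTu.not_gt hur)
  have hTr : 1 ≤ T / r := (one_le_div hr0).2 hrT.le
  set q := (T / r) ^ (a - 1) with hq
  have hq_half : 1 / 2 ≤ q := by
    have h2 : T / r ≤ 2 := by rw [div_le_iff₀ hr0]; linarith [hr.1]
    calc (1 / 2 : ℝ) = 2 ^ (-1 : ℝ) := by rw [rpow_neg_one]; norm_num
      _ ≤ (T / r) ^ (-1 : ℝ) := rpow_le_rpow_of_nonpos (by positivity) h2 (by norm_num)
      _ ≤ q := rpow_le_rpow_of_exponent_le hTr (by linarith)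
  have hq_pow : q * r ^ (b - 1) ≤ T ^ (b - 1) := by
    have h1 : q ≤ (T / r) ^ (b - 1) := rpow_le_rpow_of_exponent_le hTr (by linarith)
    calc q * r ^ (b - 1) ≤ (T / r) ^ (b - 1) * r ^ (b - 1) := by gcongr
      _ = T ^ (b - 1) := by
        rw [← mul_rpow (by positivity) hr0.le, div_mul_cancel₀ _ hr0.ne']
  have hint_left : IntervalIntegrable (fun τ => (T - τ) ^ (a - 1) * u τ) volume 0 r :=
    (hint T hT).mono_set (by
      rw [Set.uIcc_of_le hr0.le, Set.uIcc_of_le hT.le]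
      exact Set.Icc_subset_Icc_right hrT.le)
  have hint_right : IntervalIntegrable (fun τ => (T - τ) ^ (a - 1) * u τ) volume r T :=
    (hint T hT).mono_set (by
      rw [Set.uIcc_of_le hrT.le, Set.uIcc_of_le hT.le]
      exact Set.Icc_subset_Icc_left hr0.le)
  have hleft : ∫ τ in (0:ℝ)..r, (T - τ) ^ (a - 1) * u τ ≤
      q * ∫ τ in (0:ℝ)..r, (r - τ) ^ (a - 1) * u τ := by
    rw [← intervalIntegral.integral_const_mul]
    refine intervalIntegral.integral_mono_on_of_le_Ioo hr0.le hint_left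
      ((hint r hr0).const_mul q) fun τ hτ => ?_
    have hrτ : 0 < r - τ := sub_pos.2 hτ.2
    rw [← mul_assoc, hq, ← mul_rpow (by positivity) hrτ.le]
    refine mul_le_mul_of_nonneg_right (rpow_le_rpow_of_nonpos (by positivity) ?_ (by linarith))
      (hpos τ hτ.1 (hτ.2.trans hrT)).le
    rw [div_mul_eq_mul_div, div_le_iff₀ hr0]
    nlinarith [hτ.1]
  have hright : ∫ τ in r..T, (T - τ) ^ (a - 1) * u τ ≤ u r * (δ ^ a / a) := by
    have hker : IntervalIntegrable (fun τ => (T - τ) ^ (a - 1)) volume r T := by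
      simpa using ((intervalIntegral.intervalIntegrable_rpow' (a := 0) (b := T - r)
        (by linarith : -1 < a - 1)).comp_sub_left T).symm
    calc ∫ τ in r..T, (T - τ) ^ (a - 1) * u τ
        ≤ ∫ τ in r..T, (T - τ) ^ (a - 1) * u r := by
          refine intervalIntegral.integral_mono_on hrT.le hint_right (hker.mul_const _)
            fun τ hτ => ?_
          have := rpow_nonneg (sub_nonneg.2 hτ.2) (a - 1)
          gcongr
          exact hrmax ⟨hr.1.trans hτ.1, hτ.2⟩
      _ = u r * ((T - r) ^ a / a) := by
          rw [intervalIntegral.integral_mul_const,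
            intervalIntegral.integral_comp_sub_left (fun x => x ^ (a - 1)), sub_self,
            integral_rpow (.inl (by linarith)), sub_add_cancel, zero_rpow ha.ne', sub_zero,
            mul_comm]
      _ ≤ u r * (δ ^ a / a) := by
          gcongr
          linarith [hr.1]
  have hsplit := intervalIntegral.integral_add_adjacent_intervals hint_left hint_right
  have h1 := heq T hT
  have h2 := heq r hr0
  rw [← hsplit] at h1
  have h3 := mul_le_mul_of_nonneg_left hleft hm.le
  have h4 := mul_le_mul_of_nonneg_left hright hm.le
  have h5 := mul_le_mul_of_nonneg_left hq_pow hc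
  have h6 := mul_lt_mul_of_pos_right (hδm.trans_le hq_half) hur
  nlinarith

section RenewalFunction

variable {a1 a2 C1 C2 : ℝ}

theorem ufun_eq (a1 a2 C1 C2 t : ℝ) :
    ufun a1 a2 C1 C2 t =
      C1⁻¹ * (t ^ (a1 - 1) * ML (a1 - a2) a1 (-(C2 / C1) * t ^ (a1 - a2))) := by
  rw [ufun, show -C2 * t ^ (a1 - a2) / C1 = -(C2 / C1) * t ^ (a1 - a2) by ring]
  ring

theorem continuousOn_ufun (ha2 : 0 < a2) (ha12 : a2 < a1) :
    ContinuousOn (ufun a1 a2 C1 C2) (Set.Ioi 0) := by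
  have hML := continuous_ML (sub_pos.2 ha12) (ha2.trans ha12)
  have hpow (p : ℝ) : ContinuousOn (fun t : ℝ => t ^ p) (Set.Ioi 0) :=
    continuousOn_id.rpow_const fun t ht => .inl (ne_of_gt ht)
  simp_rw [funext (ufun_eq a1 a2 C1 C2)]
  exact continuousOn_const.mul ((hpow _).mul
    (hML.comp_continuousOn (continuousOn_const.mul (hpow _))))

theorem intervalIntegrable_rpow_mul_ufun (ha2 : 0 < a2) (ha12 : a2 < a1) {c t : ℝ} (hc : 0 < c)
    (ht : 0 < t) :
    IntervalIntegrable (fun τ => (t - τ) ^ (c - 1) * ufun a1 a2 C1 C2 τ) volume 0 t := by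
  have hML := continuous_ML (sub_pos.2 ha12) (ha2.trans ha12)
  have hcont : Continuous fun τ : ℝ =>
      C1⁻¹ * ML (a1 - a2) a1 (-(C2 / C1) * τ ^ (a1 - a2)) :=
    continuous_const.mul (hML.comp (continuous_const.mul
      (continuous_id.rpow_const fun _ => .inr (sub_pos.2 ha12).le)))
  refine ((intervalIntegrable_rpow_mul_rpow (ha2.trans ha12) hc ht).mul_continuousOn
    hcont.continuousOn).congr fun τ _ => ?_
  simp only [ufun_eq]
  ring

theorem intervalIntegrable_ufun (ha2 : 0 < a2) (ha12 : a2 < a1) {t : ℝ} (ht : 0 < t) :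
    IntervalIntegrable (ufun a1 a2 C1 C2) volume 0 t := by
  simpa using intervalIntegrable_rpow_mul_ufun ha2 ha12 one_pos ht

theorem integral_ufun (ha2 : 0 < a2) (ha12 : a2 < a1) {t : ℝ} (ht : 0 < t) :
    ∫ τ in (0:ℝ)..t, ufun a1 a2 C1 C2 τ = Ufun a1 a2 C1 C2 t := by
  have h := integral_rpow_mul_ML (sub_pos.2 ha12) (ha2.trans ha12) one_pos ht (-(C2 / C1))
  simp only [sub_self, rpow_zero, one_mul, Gamma_one, add_sub_cancel_right] at h
  simp_rw [ufun_eq]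
  rw [intervalIntegral.integral_const_mul, h, Ufun,
    show -C2 * t ^ (a1 - a2) / C1 = -(C2 / C1) * t ^ (a1 - a2) by ring]
  ring

/-- The renewal density solves `C₁ u + C₂ I^{α₁ - α₂} u = t ^ (α₁ - 1) / Γ(α₁)`. -/
theorem ufun_volterra (ha2 : 0 < a2) (ha12 : a2 < a1) {t : ℝ} (ht : 0 < t) :
    ufun a1 a2 C1 C2 t + C2 / C1 / Gamma (a1 - a2) *
      ∫ τ in (0:ℝ)..t, (t - τ) ^ (a1 - a2 - 1) * ufun a1 a2 C1 C2 τ =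
      C1⁻¹ / Gamma a1 * t ^ (a1 - 1) := by
  have ha := sub_pos.2 ha12
  have hb := ha2.trans ha12
  have h := integral_rpow_mul_ML ha hb ha ht (-(C2 / C1))
  have hG := Gamma_pos_of_pos ha
  have hint : ∫ τ in (0:ℝ)..t, (t - τ) ^ (a1 - a2 - 1) * ufun a1 a2 C1 C2 τ =
      C1⁻¹ * (Gamma (a1 - a2) * (t ^ (a1 + (a1 - a2) - 1) *
        ML (a1 - a2) (a1 + (a1 - a2)) (-(C2 / C1) * t ^ (a1 - a2)))) := by
    rw [← h, ← intervalIntegral.integral_const_mul]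
    simp_rw [ufun_eq]
    congr 1 with τ
    ring
  rw [hint, ufun_eq, ML_eq_add ha hb,
    show a1 + (a1 - a2) - 1 = (a1 - 1) + (a1 - a2) by ring, rpow_add ht]
  linear_combination C2 / C1 * C1⁻¹ * (t ^ (a1 - 1) * t ^ (a1 - a2)) *
    ML (a1 - a2) (a1 + (a1 - a2)) (-(C2 / C1) * t ^ (a1 - a2)) * mul_inv_cancel₀ hG.ne'

theorem ufun_pos (ha2 : 0 < a2) (ha12 : a2 < a1) (ha1 : a1 < 1) (hC1 : 0 < C1) (hC2 : 0 < C2)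
    {t : ℝ} (ht : 0 < t) : 0 < ufun a1 a2 C1 C2 t := by
  have ha := sub_pos.2 ha12
  have hb := ha2.trans ha12
  have hGa := Gamma_pos_of_pos ha
  have hGb := Gamma_pos_of_pos hb
  have hnear : ∀ᶠ t in 𝓝[>] 0, 0 < ufun a1 a2 C1 C2 t := by
    have hcont : Continuous fun t : ℝ => ML (a1 - a2) a1 (-(C2 / C1) * t ^ (a1 - a2)) :=
      (continuous_ML ha hb).comp (continuous_const.mul
        (continuous_id.rpow_const fun _ => .inr ha.le))
    have h0 : 0 < ML (a1 - a2) a1 (-(C2 / C1) * 0 ^ (a1 - a2)) := by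
      rw [zero_rpow ha.ne', mul_zero, ML_zero]
      positivity
    filter_upwards [nhdsWithin_le_nhds (hcont.continuousAt.eventually (lt_mem_nhds h0)),
      self_mem_nhdsWithin] with t ht ht0
    have ht0 : 0 < t := ht0
    rw [ufun_eq]
    positivity
  exact pos_of_volterra ha (by linarith) (by linarith) (by positivity) (by positivity)
    (continuousOn_ufun ha2 ha12) hnear
    (fun t ht => intervalIntegrable_rpow_mul_ufun ha2 ha12 ha ht)
    (fun t ht => ufun_volterra ha2 ha12 ht) ht

theorem Ufun_sub_Ufun (ha2 : 0 < a2) (ha12 : a2 < a1) {r t : ℝ} (hr : 0 < r) (hrt : r ≤ t) :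
    Ufun a1 a2 C1 C2 t - Ufun a1 a2 C1 C2 r = ∫ τ in r..t, ufun a1 a2 C1 C2 τ := by
  rw [← integral_ufun ha2 ha12 hr, ← integral_ufun ha2 ha12 (hr.trans_le hrt),
    intervalIntegral.integral_interval_sub_left
      (intervalIntegrable_ufun ha2 ha12 (hr.trans_le hrt)) (intervalIntegrable_ufun ha2 ha12 hr)]

theorem Ufun_mono (ha2 : 0 < a2) (ha12 : a2 < a1) (ha1 : a1 < 1) (hC1 : 0 < C1) (hC2 : 0 < C2) :
    MonotoneOn (Ufun a1 a2 C1 C2) (Set.Ioi 0) := by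
  intro r hr t _ hrt
  rw [← sub_nonneg, Ufun_sub_Ufun ha2 ha12 hr hrt]
  exact intervalIntegral.integral_nonneg hrt fun τ hτ =>
    (ufun_pos ha2 ha12 ha1 hC1 hC2 (lt_of_lt_of_le hr hτ.1)).le

theorem Ufun_pos (ha2 : 0 < a2) (ha12 : a2 < a1) (ha1 : a1 < 1) (hC1 : 0 < C1) (hC2 : 0 < C2)
    {t : ℝ} (ht : 0 < t) : 0 < Ufun a1 a2 C1 C2 t := by
  rw [← integral_ufun ha2 ha12 ht]
  exact intervalIntegral.intervalIntegral_pos_of_pos_on (intervalIntegrable_ufun ha2 ha12 ht)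
    (fun τ hτ => ufun_pos ha2 ha12 ha1 hC1 hC2 hτ.1) ht

theorem Ufun_sub_le (ha2 : 0 < a2) (ha12 : a2 < a1) (ha1 : a1 < 1) (hC1 : 0 < C1) (hC2 : 0 < C2)
    {s t : ℝ} (hs : 0 < s) (hst : s < t) :
    Ufun a1 a2 C1 C2 t - Ufun a1 a2 C1 C2 (t - s) ≤
      Gamma (a1 - a2) / (C2 * Gamma a1) * s ^ (1 - (a1 - a2)) * t ^ (a1 - 1) := by
  have ht : 0 < t := hs.trans hst
  have hts : 0 < t - s := sub_pos.2 hst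
  have hG := Gamma_pos_of_pos (sub_pos.2 ha12)
  have hG1 := Gamma_pos_of_pos (ha2.trans ha12)
  have hupos {τ : ℝ} (hτ : 0 < τ) := ufun_pos ha2 ha12 ha1 hC1 hC2 hτ
  have hint := intervalIntegrable_rpow_mul_ufun (C1 := C1) (C2 := C2) ha2 ha12
    (sub_pos.2 ha12) ht
  have hsub : Set.uIcc (t - s) t ⊆ Set.uIcc 0 t := by
    rw [Set.uIcc_of_le (by linarith), Set.uIcc_of_le ht.le]
    exact Set.Icc_subset_Icc_left hts.le
  have hlower : s ^ (a1 - a2 - 1) * (Ufun a1 a2 C1 C2 t - Ufun a1 a2 C1 C2 (t - s)) ≤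
      ∫ τ in (0:ℝ)..t, (t - τ) ^ (a1 - a2 - 1) * ufun a1 a2 C1 C2 τ := by
    rw [Ufun_sub_Ufun ha2 ha12 hts (by linarith), ← intervalIntegral.integral_const_mul]
    calc ∫ τ in (t - s)..t, s ^ (a1 - a2 - 1) * ufun a1 a2 C1 C2 τ
        ≤ ∫ τ in (t - s)..t, (t - τ) ^ (a1 - a2 - 1) * ufun a1 a2 C1 C2 τ := by
          refine intervalIntegral.integral_mono_on_of_le_Ioo (by linarith)
            (((intervalIntegrable_ufun ha2 ha12 ht).mono_set hsub).const_mul _)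
            (hint.mono_set hsub) fun τ hτ => ?_
          exact mul_le_mul_of_nonneg_right
            (rpow_le_rpow_of_nonpos (sub_pos.2 hτ.2) (by linarith [hτ.1]) (by linarith))
            (hupos (hts.trans hτ.1)).le
      _ ≤ _ := by
          refine intervalIntegral.integral_mono_interval hts.le (by linarith) le_rfl ?_ hint
          filter_upwards [ae_restrict_mem measurableSet_Ioc] with τ hτ
          exact mul_nonneg (rpow_nonneg (sub_nonneg.2 hτ.2) _) (hupos hτ.1).le
  have hupper : C2 / C1 / Gamma (a1 - a2) *
      ∫ τ in (0:ℝ)..t, (t - τ) ^ (a1 - a2 - 1) * ufun a1 a2 C1 C2 τ ≤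
      C1⁻¹ / Gamma a1 * t ^ (a1 - 1) := by
    linarith [ufun_volterra (C1 := C1) (C2 := C2) ha2 ha12 ht, hupos ht]
  have h := (mul_le_mul_of_nonneg_left hlower
    (show 0 ≤ C2 / C1 / Gamma (a1 - a2) by positivity)).trans hupper
  have hpow : s ^ (1 - (a1 - a2)) * s ^ (a1 - a2 - 1) = 1 := by
    rw [← rpow_add hs]; simp
  have hK : 0 ≤ s ^ (1 - (a1 - a2)) * (Gamma (a1 - a2) * C1 / C2) := by positivity
  calc Ufun a1 a2 C1 C2 t - Ufun a1 a2 C1 C2 (t - s)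
      = s ^ (1 - (a1 - a2)) * s ^ (a1 - a2 - 1) *
          (Ufun a1 a2 C1 C2 t - Ufun a1 a2 C1 C2 (t - s)) := by rw [hpow, one_mul]
    _ = s ^ (1 - (a1 - a2)) * (Gamma (a1 - a2) * C1 / C2) * (C2 / C1 / Gamma (a1 - a2) *
          (s ^ (a1 - a2 - 1) * (Ufun a1 a2 C1 C2 t - Ufun a1 a2 C1 C2 (t - s)))) := by
        field_simp
    _ ≤ s ^ (1 - (a1 - a2)) * (Gamma (a1 - a2) * C1 / C2) *
          (C1⁻¹ / Gamma a1 * t ^ (a1 - 1)) := mul_le_mul_of_nonneg_left h hK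
    _ = _ := by field_simp

theorem Ifun_mem_Icc (ha2 : 0 < a2) (ha12 : a2 < a1) (ha1 : a1 < 1) (hC1 : 0 < C1) (hC2 : 0 < C2)
    {s t : ℝ} (hs : 0 < s) (hst : s < t) :
    Ifun a1 a2 C1 C2 s t ∈ Set.Icc (Ufun a1 a2 C1 C2 (t - s) * Ufun a1 a2 C1 C2 s)
      (Ufun a1 a2 C1 C2 t * Ufun a1 a2 C1 C2 s) := by
  have ha := sub_pos.2 ha12
  have hmono := Ufun_mono ha2 ha12 ha1 hC1 hC2
  have hupos {τ : ℝ} (hτ : 0 < τ) := ufun_pos ha2 ha12 ha1 hC1 hC2 hτ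
  have hu := intervalIntegrable_ufun (C1 := C1) (C2 := C2) ha2 ha12 hs
  have hUcont : Continuous (Ufun a1 a2 C1 C2) := by
    have hML := continuous_ML ha (show 0 < a1 + 1 by linarith)
    have hpow {p : ℝ} (hp : 0 < p) : Continuous fun t : ℝ => t ^ p :=
      continuous_id.rpow_const fun _ => .inr hp.le
    exact ((hpow (ha2.trans ha12)).div_const _).mul
      (hML.comp ((continuous_const.mul (hpow ha)).div_const _))
  have hprod : IntervalIntegrable
      (fun τ => Ufun a1 a2 C1 C2 (t - τ) * ufun a1 a2 C1 C2 τ) volume 0 s :=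
    hu.continuousOn_mul (hUcont.comp (continuous_sub_left t)).continuousOn
  rw [← integral_ufun ha2 ha12 hs, ← intervalIntegral.integral_const_mul,
    ← intervalIntegral.integral_const_mul]
  constructor
  · refine intervalIntegral.integral_mono_on_of_le_Ioo hs.le (hu.const_mul _) hprod fun τ hτ => ?_
    exact mul_le_mul_of_nonneg_right (hmono (sub_pos.2 hst) (sub_pos.2 (hτ.2.trans hst))
      (by linarith [hτ.2])) (hupos hτ.1).le
  · refine intervalIntegral.integral_mono_on_of_le_Ioo hs.le hprod (hu.const_mul _) fun τ hτ => ?_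
    exact mul_le_mul_of_nonneg_right (hmono (sub_pos.2 (hτ.2.trans hst)) (hs.trans hst)
      (by linarith [hτ.1])) (hupos hτ.1).le

end RenewalFunction

/-- For every fixed `s > 0`, `I(s,t)/(U(s)U(t)) → 1` as `t → ∞`. -/
theorem stmt_3 (a1 a2 C1 C2 : ℝ) (ha2 : 0 < a2) (ha12 : a2 < a1) (ha1 : a1 < 1)
    (hC1 : 0 < C1) (hC2 : 0 < C2) (hC : C1 + C2 = 1) (s : ℝ) (hs : 0 < s) :
    Tendsto (fun t : ℝ =>
        Ifun a1 a2 C1 C2 s t / (Ufun a1 a2 C1 C2 s * Ufun a1 a2 C1 C2 t))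
      atTop (𝓝 1) := by
  have hUs := Ufun_pos ha2 ha12 ha1 hC1 hC2 hs
  have hlim : Tendsto (fun t : ℝ => 1 - Gamma (a1 - a2) / (C2 * Gamma a1) *
      s ^ (1 - (a1 - a2)) * t ^ (a1 - 1) / Ufun a1 a2 C1 C2 s) atTop (𝓝 1) := by
    have h := tendsto_rpow_neg_atTop (sub_pos.2 ha1)
    rw [neg_sub] at h
    simpa using ((h.const_mul (Gamma (a1 - a2) / (C2 * Gamma a1) *
      s ^ (1 - (a1 - a2)))).div_const (Ufun a1 a2 C1 C2 s)).const_sub 1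
  refine tendsto_of_tendsto_of_tendsto_of_le_of_le' hlim tendsto_const_nhds ?_ ?_
  all_goals
    filter_upwards [eventually_gt_atTop s] with t hst
    have hUt := Ufun_pos ha2 ha12 ha1 hC1 hC2 (hs.trans hst)
    obtain ⟨hlow, hup⟩ := Ifun_mem_Icc ha2 ha12 ha1 hC1 hC2 hs hst
  · have hsub := Ufun_sub_le ha2 ha12 ha1 hC1 hC2 hs hst
    have hUst := Ufun_mono ha2 ha12 ha1 hC1 hC2 hs (hs.trans hst) hst.le
    have hG := Gamma_pos_of_pos (sub_pos.2 ha12)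
    have hG1 := Gamma_pos_of_pos (ha2.trans ha12)
    have ht := hs.trans hst
    set B := Gamma (a1 - a2) / (C2 * Gamma a1) * s ^ (1 - (a1 - a2)) * t ^ (a1 - 1) with hB
    have hB0 : 0 ≤ B := by positivity
    calc 1 - B / Ufun a1 a2 C1 C2 s ≤ 1 - B / Ufun a1 a2 C1 C2 t := by gcongr
      _ = (Ufun a1 a2 C1 C2 t - B) / Ufun a1 a2 C1 C2 t := by field_simp
      _ ≤ Ufun a1 a2 C1 C2 (t - s) / Ufun a1 a2 C1 C2 t := by gcongr; linarith
      _ = Ufun a1 a2 C1 C2 (t - s) * Ufun a1 a2 C1 C2 s /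
            (Ufun a1 a2 C1 C2 s * Ufun a1 a2 C1 C2 t) := by field_simp
      _ ≤ _ := by gcongr
  · rw [div_le_one (by positivity), mul_comm]
    exact hup
end

section
/- (Remark 3.2, inverse stable subordinator case) Let 0 < α < 1, and define U_α(t) = t^α/Γ(α+1), u_α(t) = t^{α−1}/Γ(α), and Cov_α(s,t) = ∫₀^{min(s,t)} (U_α(s−τ) + U_α(t−τ)) u_α(τ) dτ − U_α(s)U_α(t). Then for every fixed s > 0, lim_{t→∞} Cov_α(s,t) = s^{2α}/Γ(2α+1). -/
open Real MeasureTheory Filter Topology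

/-- The Euler integral `∫₀ˢ (s - τ)^α τ^(α-1) dτ` in terms of Gamma values. -/
lemma integral_sub_rpow_mul_rpow_sub_one {α s : ℝ} (h0 : 0 < α) (hs : 0 < s) :
    ∫ τ in (0:ℝ)..s, (s - τ) ^ α * τ ^ (α - 1) =
      s ^ (2 * α) * (Real.Gamma α * Real.Gamma (α + 1) / Real.Gamma (2 * α + 1)) := by
  have h := Complex.betaIntegral_scaled (α : ℂ) ((α + 1 : ℝ) : ℂ) hs
  have hG := Complex.Gamma_mul_Gamma_eq_betaIntegral (s := (α : ℂ)) (t := ((α + 1 : ℝ) : ℂ))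
    (by simpa using h0) (by rw [Complex.ofReal_re]; linarith)
  have hne : Real.Gamma (2 * α + 1) ≠ 0 := (Real.Gamma_pos_of_pos (by linarith)).ne'
  have e1 : (α : ℂ) + ((α + 1 : ℝ) : ℂ) = ((2 * α + 1 : ℝ) : ℂ) := by push_cast; ring
  have e2 : (α : ℂ) + ((α + 1 : ℝ) : ℂ) - 1 = ((2 * α : ℝ) : ℂ) := by push_cast; ring
  rw [e1, Complex.Gamma_ofReal, Complex.Gamma_ofReal, Complex.Gamma_ofReal] at hG
  have hB : Complex.betaIntegral (α : ℂ) ((α + 1 : ℝ) : ℂ) =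
      ((Real.Gamma α * Real.Gamma (α + 1) / Real.Gamma (2 * α + 1) : ℝ) : ℂ) := by
    have : (Real.Gamma (2 * α + 1) : ℂ) ≠ 0 := by exact_mod_cast hne
    rw [Complex.ofReal_div, Complex.ofReal_mul, hG, mul_div_cancel_left₀ _ this]
  rw [e2, hB, ← Complex.ofReal_cpow hs.le, ← Complex.ofReal_mul] at h
  apply Complex.ofReal_injective
  rw [← h, ← intervalIntegral.integral_ofReal]
  refine intervalIntegral.integral_congr fun x hx => ?_
  rw [Set.uIcc_of_le hs.le] at hx
  rw [Complex.ofReal_mul, Complex.ofReal_cpow hx.1, Complex.ofReal_cpow (sub_nonneg.2 hx.2),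
    mul_comm]
  push_cast
  rw [add_sub_cancel_right]

lemma intervalIntegrable_sub_rpow_mul_rpow_sub_one {α : ℝ} (h0 : 0 < α) (s t : ℝ) :
    IntervalIntegrable (fun τ : ℝ => (t - τ) ^ α * τ ^ (α - 1)) volume 0 s := by
  have hc : Continuous fun τ : ℝ => (t - τ) ^ α :=
    (continuous_const.sub continuous_id).rpow_const fun _ => Or.inr h0.le
  exact (intervalIntegral.intervalIntegrable_rpow' (by linarith)).continuousOn_mul hc.continuousOn

lemma rpow_sub_sub_rpow_le {α t τ : ℝ} (h1 : α ≤ 1) (ht : 0 < t) (hτ : 0 ≤ τ)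
    (hτt : τ < t) : t ^ α - (t - τ) ^ α ≤ τ * t ^ (α - 1) := by
  have hd : 0 < (t - τ) / t := div_pos (by linarith) ht
  have h : (t - τ) / t ≤ ((t - τ) / t) ^ α := by
    simpa using Real.rpow_le_rpow_of_exponent_ge hd
      ((div_le_one ht).2 (by linarith)) h1
  rw [Real.div_rpow (by linarith) ht.le, div_le_div_iff₀ ht (by positivity)] at h
  rw [Real.rpow_sub_one ht.ne', mul_div_assoc', le_div_iff₀ ht]
  linarith

lemma tendsto_integral_sub_rpow_mul_rpow_sub_one {α s : ℝ} (h0 : 0 < α) (h1 : α < 1)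
    (hs : 0 < s) :
    Tendsto (fun t : ℝ => ∫ τ in (0:ℝ)..s, ((t - τ) ^ α - t ^ α) * τ ^ (α - 1))
      atTop (𝓝 0) := by
  have hlim : Tendsto (fun t : ℝ => ∫ τ in (0:ℝ)..s, s * t ^ (α - 1) * τ ^ (α - 1))
      atTop (𝓝 0) := by
    simp only [intervalIntegral.integral_const_mul]
    have h := tendsto_rpow_neg_atTop (y := 1 - α) (by linarith)
    rw [neg_sub] at h
    simpa using (h.const_mul s).mul_const (∫ τ in (0:ℝ)..s, τ ^ (α - 1))
  refine squeeze_zero_norm' ?_ hlim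
  filter_upwards [eventually_gt_atTop s] with t ht
  refine intervalIntegral.norm_integral_le_of_norm_le hs.le (ae_of_all _ fun τ hτ => ?_)
    ((intervalIntegral.intervalIntegrable_rpow' (by linarith)).const_mul _)
  have ht0 : 0 < t := hs.trans ht
  have hp : 0 < t ^ (α - 1) := Real.rpow_pos_of_pos ht0 _
  have hle : (t - τ) ^ α ≤ t ^ α :=
    Real.rpow_le_rpow (by linarith [hτ.2]) (by linarith [hτ.1]) h0.le
  rw [norm_mul, Real.norm_of_nonneg (Real.rpow_nonneg hτ.1.le _),
    Real.norm_of_nonpos (by linarith)]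
  refine mul_le_mul_of_nonneg_right ?_ (Real.rpow_nonneg hτ.1.le _)
  have := rpow_sub_sub_rpow_le h1.le ht0 hτ.1.le (hτ.2.trans_lt ht)
  have := mul_le_mul_of_nonneg_right hτ.2 hp.le
  linarith

/-- Remark 3.2 (inverse stable subordinator case): with `U_α(t) = t^α/Γ(α+1)` and
`u_α(t) = t^{α-1}/Γ(α)`, the covariance of the inverse `α`-stable subordinator satisfies
`Cov_α(s,t) → s^{2α}/Γ(2α+1)` as `t → ∞`, for every fixed `s > 0`. -/
theorem stmt_5 (α : ℝ) (h0 : 0 < α) (h1 : α < 1) (s : ℝ) (hs : 0 < s) :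
    Tendsto (fun t : ℝ =>
        (∫ τ in (0:ℝ)..(min s t),
            ((s - τ) ^ α / Real.Gamma (α + 1) + (t - τ) ^ α / Real.Gamma (α + 1))
              * (τ ^ (α - 1) / Real.Gamma α))
          - s ^ α / Real.Gamma (α + 1) * (t ^ α / Real.Gamma (α + 1)))
      atTop (𝓝 (s ^ (2 * α) / Real.Gamma (2 * α + 1))) := by
  have hGα : Real.Gamma α ≠ 0 := (Real.Gamma_pos_of_pos h0).ne'
  have hG1 : Real.Gamma (α + 1) ≠ 0 := (Real.Gamma_pos_of_pos (by linarith)).ne'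
  have hlim := ((tendsto_integral_sub_rpow_mul_rpow_sub_one h0 h1 hs).const_mul
    (1 / (Real.Gamma (α + 1) * Real.Gamma α))).const_add
    (s ^ (2 * α) / Real.Gamma (2 * α + 1))
  rw [mul_zero, add_zero] at hlim
  refine hlim.congr' ?_
  filter_upwards [eventually_ge_atTop s] with t ht
  have hpow : ∫ τ in (0:ℝ)..s, τ ^ (α - 1) = s ^ α / α := by
    rw [integral_rpow (Or.inl (by linarith)), sub_add_cancel, Real.zero_rpow h0.ne', sub_zero]
  have hsplit : ∀ τ : ℝ,
      ((s - τ) ^ α / Real.Gamma (α + 1) + (t - τ) ^ α / Real.Gamma (α + 1))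
        * (τ ^ (α - 1) / Real.Gamma α) =
      1 / (Real.Gamma (α + 1) * Real.Gamma α) *
        ((s - τ) ^ α * τ ^ (α - 1) + (t - τ) ^ α * τ ^ (α - 1)) := by
    intro τ
    field_simp
  simp only [sub_mul, hsplit]
  rw [min_eq_left ht, intervalIntegral.integral_const_mul,
    intervalIntegral.integral_add (intervalIntegrable_sub_rpow_mul_rpow_sub_one h0 s s)
      (intervalIntegrable_sub_rpow_mul_rpow_sub_one h0 s t),
    intervalIntegral.integral_sub (intervalIntegrable_sub_rpow_mul_rpow_sub_one h0 s t)
      ((intervalIntegral.intervalIntegrable_rpow' (by linarith)).const_mul _),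
    intervalIntegral.integral_const_mul, hpow, integral_sub_rpow_mul_rpow_sub_one h0 hs]
  rw [Real.Gamma_add_one h0.ne']
  have hG2 : Real.Gamma (2 * α + 1) ≠ 0 := (Real.Gamma_pos_of_pos (by linarith)).ne'
  field_simp
  ring
end

section
/- (Proposition 3.2) The variance of the inverse mixed stable subordinator satisfies lim_{t→∞} t^{−2α₂} Var_Y(t) = (1/C₂²) (2/Γ(2α₂+1) − 1/Γ(α₂+1)²). -/
open Real MeasureTheory Filter Topology

namespace MittagLeffler

open Set

lemma rpow_mul_exp_neg_le_Gamma {R y : ℝ} (hR : 0 < R) (hy : 1 ≤ y) :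
    R ^ (y - 1) * rexp (-R) ≤ Real.Gamma y := by
  have hint := Real.GammaIntegral_convergent (s := y) (by linarith)
  rw [Real.Gamma_eq_integral (by linarith)]
  calc R ^ (y - 1) * rexp (-R) = ∫ x in Ioi R, rexp (-x) * R ^ (y - 1) := by
        rw [integral_mul_const, integral_exp_neg_Ioi, mul_comm]
    _ ≤ ∫ x in Ioi R, rexp (-x) * x ^ (y - 1) := by
        refine setIntegral_mono_on ((integrableOn_exp_neg_Ioi R).mul_const _)
          (hint.mono_set (Ioi_subset_Ioi hR.le)) measurableSet_Ioi fun x hx => ?_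
        have : R ^ (y - 1) ≤ x ^ (y - 1) :=
          Real.rpow_le_rpow hR.le (le_of_lt hx) (by linarith)
        gcongr
    _ ≤ ∫ x in Ioi 0, rexp (-x) * x ^ (y - 1) := by
        refine setIntegral_mono_set hint ?_ (Ioi_subset_Ioi hR.le).eventuallyLE
        refine (ae_restrict_iff' measurableSet_Ioi).2 (ae_of_all _ fun x hx => ?_)
        have : (0:ℝ) < x := hx
        simp only [Pi.zero_apply]
        positivity

/-- The Mittag-Leffler type series `∑ q k * x ^ k / Γ (k μ + b)`. -/
noncomputable def series (q : ℕ → ℝ) (μ b x : ℝ) : ℝ :=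
  ∑' k : ℕ, q k * x ^ k / Real.Gamma ((k : ℝ) * μ + b)

variable {q p : ℕ → ℝ} {μ b c d x : ℝ}

lemma arg_pos (hμ : 0 < μ) (hb : 0 < b) (k : ℕ) : 0 < (k : ℝ) * μ + b := by positivity

lemma summable_succ_mul_pow_div_Gamma (hμ : 0 < μ) (hx : 0 ≤ x) :
    Summable fun k : ℕ => ((k : ℝ) + 1) * x ^ k / Real.Gamma ((k : ℝ) * μ + b) := by
  set R : ℝ := (2 * x + 1) ^ (1 / μ) with hRdef
  have hR : 0 < R := by positivity
  have hRμ : R ^ μ = 2 * x + 1 := by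
    rw [hRdef, ← Real.rpow_mul (by positivity), one_div_mul_cancel hμ.ne', Real.rpow_one]
  have hρ : x / (2 * x + 1) < 1 := by rw [div_lt_one (by positivity)]; linarith
  have hρ0 : 0 ≤ x / (2 * x + 1) := by positivity
  have hs : Summable fun k : ℕ =>
      (R ^ (1 - b) * rexp R) * (((k : ℝ) + 1) * (x / (2 * x + 1)) ^ k) := by
    apply Summable.mul_left
    have h1 := summable_pow_mul_geometric_of_norm_lt_one (R := ℝ) 1
      (r := x / (2 * x + 1)) (by rwa [Real.norm_of_nonneg hρ0])
    have h2 := summable_geometric_of_lt_one hρ0 hρ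
    refine (h1.add h2).congr fun k => ?_
    simp only [pow_one]; ring
  refine hs.of_norm_bounded_eventually_nat ?_
  have hev : ∀ᶠ k : ℕ in atTop, 1 ≤ (k : ℝ) * μ + b :=
    (tendsto_atTop_add_const_right _ _
      (tendsto_natCast_atTop_atTop.atTop_mul_const hμ)).eventually_ge_atTop 1
  filter_upwards [hev] with k hk
  have hG := rpow_mul_exp_neg_le_Gamma hR hk
  have hG0 : 0 < R ^ ((k : ℝ) * μ + b - 1) * rexp (-R) := by positivity
  have hGp : 0 < Real.Gamma ((k : ℝ) * μ + b) := hG0.trans_le hG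
  rw [Real.norm_of_nonneg (by positivity)]
  calc ((k : ℝ) + 1) * x ^ k / Real.Gamma ((k : ℝ) * μ + b)
      ≤ ((k : ℝ) + 1) * x ^ k / (R ^ ((k : ℝ) * μ + b - 1) * rexp (-R)) := by gcongr
    _ = _ := by
      have : R ^ ((k : ℝ) * μ + b - 1) = (2 * x + 1) ^ k * (R ^ (1 - b))⁻¹ := by
        rw [← hRμ, ← Real.rpow_neg hR.le, ← Real.rpow_natCast (R ^ μ), ← Real.rpow_mul hR.le,
          ← Real.rpow_add hR]
        ring_nf
      rw [this, Real.exp_neg, div_pow]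
      field_simp

lemma abs_term (hμ : 0 < μ) (hb : 0 < b) (k : ℕ) :
    |q k * x ^ k / Real.Gamma ((k : ℝ) * μ + b)|
      = |q k| * |x| ^ k / Real.Gamma ((k : ℝ) * μ + b) := by
  rw [abs_div, abs_mul, abs_pow, abs_of_pos (Real.Gamma_pos_of_pos (arg_pos hμ hb k))]

lemma summable_abs_term (hq : ∀ k, |q k| ≤ k + 1) (hμ : 0 < μ) (hb : 0 < b) :
    Summable fun k : ℕ => |q k| * |x| ^ k / Real.Gamma ((k : ℝ) * μ + b) := by
  refine (summable_succ_mul_pow_div_Gamma (b := b) hμ (abs_nonneg x)).of_nonneg_of_le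
    (fun k => ?_) fun k => ?_
  · have := Real.Gamma_pos_of_pos (arg_pos hμ hb k)
    positivity
  · have := Real.Gamma_pos_of_pos (arg_pos hμ hb k)
    have := hq k
    gcongr

lemma summable_term (hq : ∀ k, |q k| ≤ k + 1) (hμ : 0 < μ) (hb : 0 < b) :
    Summable fun k : ℕ => q k * x ^ k / Real.Gamma ((k : ℝ) * μ + b) :=
  ((summable_abs_term (x := x) hq hμ hb).congr fun k => (abs_term hμ hb k).symm).of_abs

lemma continuous_series (hq : ∀ k, |q k| ≤ k + 1) (hμ : 0 < μ) (hb : 0 < b) :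
    Continuous (series q μ b) := by
  rw [continuous_iff_continuousAt]
  intro x₀
  have hon : ContinuousOn (series q μ b) (Icc (-(|x₀| + 1)) (|x₀| + 1)) := by
    refine continuousOn_tsum (fun k => by fun_prop)
      (summable_abs_term (x := |x₀| + 1) hq hμ hb) fun k x hx => ?_
    have := Real.Gamma_pos_of_pos (arg_pos hμ hb k)
    rw [Real.norm_eq_abs, abs_term hμ hb]
    have : |x| ≤ |(|x₀| + 1)| := by
      rw [abs_of_nonneg (by positivity : 0 ≤ |x₀| + 1)]
      exact abs_le.2 hx
    gcongr
  refine hon.continuousAt (Icc_mem_nhds ?_ ?_)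
  · linarith [neg_abs_le x₀]
  · linarith [le_abs_self x₀]

lemma series_eq_add_mul (hq : ∀ k, |q k| ≤ k + 1) (hp : ∀ k, |p k| ≤ k + 1)
    (h0 : q 0 = p 0) (hs : ∀ k, q (k + 1) = p (k + 1) + q k) (hμ : 0 < μ) (hb : 0 < b) :
    series q μ b x = series p μ b x + x * series q μ (b + μ) x := by
  unfold series
  rw [(summable_term hq hμ hb).tsum_eq_zero_add, (summable_term hp hμ hb).tsum_eq_zero_add,
    ← tsum_mul_left, h0, add_assoc, ← Summable.tsum_add]
  · congr 2
    ext k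
    rw [hs]
    have : ((k : ℝ) * μ + (b + μ)) = ((k + 1 : ℕ) : ℝ) * μ + b := by push_cast; ring
    rw [this, pow_succ]
    ring
  · exact (summable_nat_add_iff 1).2 (summable_term hp hμ hb)
  · exact (summable_term hq hμ (by positivity)).mul_left x

lemma integrableOn_beta (hc : 0 < c) (hd : 0 < d) :
    IntegrableOn (fun s : ℝ => (1 - s) ^ (d - 1) * s ^ (c - 1)) (Ioo 0 1) := by
  have h := (Complex.betaIntegral_convergent (u := c) (v := d) (by simpa) (by simpa))
  rw [intervalIntegrable_iff_integrableOn_Ioo_of_le zero_le_one] at h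
  refine h.re.congr ?_
  refine (ae_restrict_iff' measurableSet_Ioo).2 (ae_of_all _ fun s hs => ?_)
  have h1 : (s : ℂ) ^ ((c : ℂ) - 1) = ((s ^ (c - 1) : ℝ) : ℂ) := by
    rw [Complex.ofReal_cpow hs.1.le]; push_cast; rfl
  have h2 : (1 - (s : ℂ)) ^ ((d : ℂ) - 1) = (((1 - s) ^ (d - 1) : ℝ) : ℂ) := by
    rw [Complex.ofReal_cpow (by linarith [hs.2])]; push_cast; rfl
  simp only [h1, h2, ← Complex.ofReal_mul]
  simp [mul_comm]

lemma integral_beta (hc : 0 < c) (hd : 0 < d) :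
    ∫ s in Ioo (0 : ℝ) 1, (1 - s) ^ (d - 1) * s ^ (c - 1)
      = Real.Gamma d * Real.Gamma c / Real.Gamma (c + d) := by
  have h := ProbabilityTheory.beta_eq_betaIntegralReal c d hc hd
  rw [ProbabilityTheory.beta, mul_comm (Real.Gamma c)] at h
  rw [h, Complex.betaIntegral, intervalIntegral.integral_of_le zero_le_one,
    integral_Ioc_eq_integral_Ioo]
  have : ∫ x in Ioo (0 : ℝ) 1, (x : ℂ) ^ ((c : ℂ) - 1) * (1 - (x : ℂ)) ^ ((d : ℂ) - 1)
      = ∫ x in Ioo (0 : ℝ) 1, (((1 - x) ^ (d - 1) * x ^ (c - 1) : ℝ) : ℂ) := by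
    refine setIntegral_congr_fun measurableSet_Ioo fun s hs => ?_
    have h1 : (s : ℂ) ^ ((c : ℂ) - 1) = ((s ^ (c - 1) : ℝ) : ℂ) := by
      rw [Complex.ofReal_cpow hs.1.le]; push_cast; rfl
    have h2 : (1 - (s : ℂ)) ^ ((d : ℂ) - 1) = (((1 - s) ^ (d - 1) : ℝ) : ℂ) := by
      rw [Complex.ofReal_cpow (by linarith [hs.2])]; push_cast; rfl
    simp only [h1, h2, ← Complex.ofReal_mul]
    rw [mul_comm]
  rw [this, integral_complex_ofReal, Complex.ofReal_re]

lemma integral_kernel_mul_series (hq : ∀ k, |q k| ≤ k + 1) (hμ : 0 < μ) (hc : 0 < c)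
    (hd : 0 < d) :
    ∫ s in Ioo (0 : ℝ) 1, (1 - s) ^ (d - 1) * (s ^ (c - 1) * series q μ c (x * s ^ μ))
      = Real.Gamma d * series q μ (c + d) x := by
  set F : ℕ → ℝ → ℝ := fun k s => (q k * x ^ k / Real.Gamma ((k : ℝ) * μ + c)) *
    ((1 - s) ^ (d - 1) * s ^ ((k : ℝ) * μ + c - 1)) with hF
  have hcancel : ∀ (a : ℝ) (k : ℕ), a / Real.Gamma ((k : ℝ) * μ + c) *
      (Real.Gamma d * Real.Gamma ((k : ℝ) * μ + c) / Real.Gamma ((k : ℝ) * μ + c + d))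
      = Real.Gamma d * (a / Real.Gamma ((k : ℝ) * μ + (c + d))) := fun a k => by
    have := (Real.Gamma_pos_of_pos (arg_pos hμ hc k)).ne'
    rw [← add_assoc]
    field_simp
  have hint : ∀ k, Integrable (F k) (volume.restrict (Ioo 0 1)) := fun k =>
    (integrableOn_beta (arg_pos hμ hc k) hd).const_mul _
  have hval : ∀ k, ∫ s in Ioo (0 : ℝ) 1, F k s
      = Real.Gamma d * (q k * x ^ k / Real.Gamma ((k : ℝ) * μ + (c + d))) := fun k => by
    simp only [hF]
    rw [integral_const_mul, integral_beta (arg_pos hμ hc k) hd, hcancel]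
  have hnorm : ∀ k, ∫ s in Ioo (0 : ℝ) 1, ‖F k s‖
      = Real.Gamma d * (|q k| * |x| ^ k / Real.Gamma ((k : ℝ) * μ + (c + d))) := fun k => by
    rw [← hcancel, ← abs_term hμ hc, ← integral_beta (arg_pos hμ hc k) hd, ← integral_const_mul]
    refine setIntegral_congr_fun measurableSet_Ioo fun s hs => ?_
    have h1 : 0 < 1 - s := by linarith [hs.2]
    have h2 := hs.1
    simp only [hF]
    rw [norm_mul, Real.norm_eq_abs, Real.norm_of_nonneg (by positivity)]
  have hsum := hasSum_integral_of_summable_integral_norm hint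
    (by simp only [hnorm]; exact (summable_abs_term hq hμ (by positivity)).mul_left _)
  simp only [hval] at hsum
  rw [series, ← tsum_mul_left, hsum.tsum_eq]
  refine setIntegral_congr_fun measurableSet_Ioo fun s hs => ?_
  simp only [hF, series]
  rw [← tsum_mul_left, ← tsum_mul_left]
  congr 1
  ext k
  rw [mul_pow, ← Real.rpow_natCast (s ^ μ), ← Real.rpow_mul hs.1.le,
    (by ring : (k : ℝ) * μ + c - 1 = (c - 1) + μ * k), Real.rpow_add hs.1]
  ring

lemma integral_exp_convolution_nonneg {g : ℝ → ℝ} {r : ℝ} (hg : ContinuousOn g (Ioi 0))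
    (hgi : IntervalIntegrable g volume 0 1) (hr : 0 ≤ r) :
    0 ≤ ∫ t in (0 : ℝ)..1, g t * rexp (-(r * t)) * ∫ s in (0 : ℝ)..t, g s * rexp (r * s) := by
  set k : ℝ → ℝ := fun s => g s * rexp (r * s) with hk
  set G : ℝ → ℝ := fun t => ∫ s in (0 : ℝ)..t, k s with hG
  have hki : IntervalIntegrable k volume 0 1 :=
    hgi.mul_continuousOn (Continuous.continuousOn (by fun_prop))
  have hkc : ContinuousOn k (Ioi 0) := hg.mul (Continuous.continuousOn (by fun_prop))
  have hGc : ContinuousOn G (uIcc 0 1) :=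
    intervalIntegral.continuousOn_primitive_interval' hki left_mem_uIcc
  have hGd : ∀ t ∈ Ioo (0 : ℝ) 1, HasDerivAt G (k t) t := fun t ht => by
    refine intervalIntegral.integral_hasDerivAt_right ?_ ?_ ?_
    · refine hki.mono_set ?_
      rw [uIcc_of_le ht.1.le, uIcc_of_le zero_le_one]
      exact Icc_subset_Icc_right ht.2.le
    · exact hkc.stronglyMeasurableAtFilter isOpen_Ioi t ht.1
    · exact hkc.continuousAt (Ioi_mem_nhds ht.1)
  have i1 : IntervalIntegrable (fun t => g t * rexp (-(r * t)) * G t) volume 0 1 :=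
    (hgi.mul_continuousOn (Continuous.continuousOn (by fun_prop))).mul_continuousOn hGc
  have i2 : IntervalIntegrable (fun t => r * (rexp (-(2 * r * t)) * G t ^ 2)) volume 0 1 :=
    (ContinuousOn.mul continuousOn_const
      ((Continuous.continuousOn (by fun_prop)).mul (hGc.pow 2))).intervalIntegrable
  have key := intervalIntegral.integral_eq_sub_of_hasDerivAt_of_le (zero_le_one (α := ℝ))
    (f := fun t => rexp (-(2 * r * t)) * G t ^ 2 / 2)
    (f' := fun t => g t * rexp (-(r * t)) * G t - r * (rexp (-(2 * r * t)) * G t ^ 2)) ?_ ?_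
    (i1.sub i2)
  · rw [intervalIntegral.integral_sub i1 i2] at key
    have h0 : G 0 = 0 := by simp [hG]
    have h2 : 0 ≤ ∫ t in (0 : ℝ)..1, r * (rexp (-(2 * r * t)) * G t ^ 2) :=
      intervalIntegral.integral_nonneg zero_le_one fun t _ => by positivity
    have h1 : 0 ≤ rexp (-(2 * r * 1)) * G 1 ^ 2 / 2 := by positivity
    simp only [h0] at key
    linarith
  · rw [uIcc_of_le zero_le_one] at hGc
    exact ((Continuous.continuousOn (by fun_prop)).mul (hGc.pow 2)).div_const 2
  · intro t ht
    have he : HasDerivAt (fun t => rexp (-(2 * r * t))) (rexp (-(2 * r * t)) * (-(2 * r))) t := by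
      simpa using ((hasDerivAt_id t).const_mul (2 * r)).neg.exp
    have h := (he.mul ((hGd t ht).pow 2)).div_const 2
    refine h.congr_deriv ?_
    have : rexp (-(r * t)) = rexp (-(2 * r * t)) * rexp (r * t) := by
      rw [← Real.exp_add]; ring_nf
    simp only [hk, this, Pi.pow_apply]
    push_cast
    ring

lemma integral_exp_convolution_eq {g : ℝ → ℝ} (r t : ℝ) :
    ∫ σ in Ioo (0 : ℝ) 1, t * g t * g (t * σ) * rexp (-(t * (1 - σ) * r))
      = g t * rexp (-(r * t)) * ∫ s in (0 : ℝ)..t, g s * rexp (r * s) := by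
  have h := intervalIntegral.mul_integral_comp_mul_left (a := 0) (b := 1) (c := t)
    (f := fun s => g s * rexp (r * s))
  rw [mul_zero, mul_one] at h
  rw [← h, intervalIntegral.integral_of_le zero_le_one, integral_Ioc_eq_integral_Ioo, ← mul_assoc,
    ← integral_const_mul]
  congr 1
  ext σ
  rw [show -(t * (1 - σ) * r) = -(r * t) + r * (t * σ) by ring, Real.exp_add]
  ring

lemma integral_rpow_kernel_nonneg {g : ℝ → ℝ} {M : ℝ} (hμ : 0 < μ) (hμ1 : μ < 1)
    (hc : 1 / 2 < c) (hgm : Measurable g) (hg : ContinuousOn g (Ioi 0))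
    (hM : ∀ t ∈ Ioo (0 : ℝ) 1, |g t| ≤ M * t ^ (c - 1)) :
    0 ≤ ∫ t in Ioo (0 : ℝ) 1, ∫ σ in Ioo (0 : ℝ) 1,
      t ^ μ * g t * g (t * σ) * (1 - σ) ^ (μ - 1) := by
  set ν : Measure ℝ := volume.restrict (Ioo 0 1) with hν
  set ρ : Measure ℝ := volume.restrict (Ioi 0) with hρ
  have hΓ : 0 < Real.Gamma (1 - μ) := Real.Gamma_pos_of_pos (by linarith)
  have hpow : ∀ a : ℝ, -1 < a → Integrable (fun t : ℝ => t ^ a) ν := fun a ha => by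
    rw [hν, ← IntegrableOn, ← intervalIntegrable_iff_integrableOn_Ioo_of_le zero_le_one]
    exact intervalIntegral.intervalIntegrable_rpow' ha
  have hae : ∀ᵐ p ∂(ν.prod ν), p ∈ Ioo (0 : ℝ) 1 ×ˢ Ioo (0 : ℝ) 1 := by
    rw [hν, Measure.prod_restrict]
    exact ae_restrict_mem (measurableSet_Ioo.prod measurableSet_Ioo)
  set K : ℝ × ℝ → ℝ := fun p => p.1 ^ μ * g p.1 * g (p.1 * p.2) * (1 - p.2) ^ (μ - 1) with hK
  have hKi : Integrable K (ν.prod ν) := by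
    have hb : Integrable (fun p : ℝ × ℝ => M ^ 2 * (p.1 ^ (μ + (c - 1) + (c - 1)) *
        ((1 - p.2) ^ (μ - 1) * p.2 ^ (c - 1)))) (ν.prod ν) :=
      ((hpow _ (by linarith)).mul_prod (integrableOn_beta (by linarith) hμ)).const_mul _
    refine hb.mono' (by fun_prop) ?_
    filter_upwards [hae] with p hp
    obtain ⟨⟨h1, h2⟩, h3, h4⟩ := hp
    have h5 : 0 < 1 - p.2 := by linarith
    have hm := hM p.1 ⟨h1, h2⟩
    have hm' := hM (p.1 * p.2) ⟨by positivity, by nlinarith⟩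
    simp only [hK]
    rw [norm_mul, norm_mul, norm_mul, Real.norm_of_nonneg (by positivity : 0 ≤ p.1 ^ μ),
      Real.norm_of_nonneg (by positivity : 0 ≤ (1 - p.2) ^ (μ - 1)), Real.norm_eq_abs,
      Real.norm_eq_abs]
    calc p.1 ^ μ * |g p.1| * |g (p.1 * p.2)| * (1 - p.2) ^ (μ - 1)
        ≤ p.1 ^ μ * (M * p.1 ^ (c - 1)) * (M * (p.1 * p.2) ^ (c - 1)) * (1 - p.2) ^ (μ - 1) := by
          have : 0 ≤ M * p.1 ^ (c - 1) := (abs_nonneg _).trans hm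
          gcongr
      _ = _ := by
          rw [Real.mul_rpow h1.le h3.le, Real.rpow_add h1, Real.rpow_add h1]
          ring
  set H : ℝ × ℝ → ℝ → ℝ := fun p r =>
    p.1 * g p.1 * g (p.1 * p.2) * (r ^ ((1 - μ) - 1) * rexp (-(p.1 * (1 - p.2) * r))) with hH
  have hval : ∀ p ∈ Ioo (0 : ℝ) 1 ×ˢ Ioo (0 : ℝ) 1,
      p.1 * ∫ r, r ^ ((1 - μ) - 1) * rexp (-(p.1 * (1 - p.2) * r)) ∂ρ
        = Real.Gamma (1 - μ) * (p.1 ^ μ * (1 - p.2) ^ (μ - 1)) := fun p hp => by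
    obtain ⟨⟨h1, h2⟩, h3, h4⟩ := hp
    have h5 : 0 < 1 - p.2 := by linarith
    rw [hρ, Real.integral_rpow_mul_exp_neg_mul_Ioi (by linarith) (by positivity), one_div,
      Real.inv_rpow (by positivity), ← Real.rpow_neg (by positivity),
      Real.mul_rpow h1.le h5.le]
    have : p.1 ^ μ = p.1 * p.1 ^ (-(1 - μ)) := by
      nth_rewrite 2 [← Real.rpow_one p.1]
      rw [← Real.rpow_add h1]; ring_nf
    rw [this]; ring_nf
  have hHi : Integrable (Function.uncurry H) ((ν.prod ν).prod ρ) := by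
    have hmeas : AEStronglyMeasurable (Function.uncurry H) ((ν.prod ν).prod ρ) := by
      simp only [hH]
      refine Measurable.aestronglyMeasurable ?_
      unfold Function.uncurry
      fun_prop
    rw [integrable_prod_iff hmeas]
    constructor
    · filter_upwards [hae] with p hp
      obtain ⟨⟨h1, h2⟩, h3, h4⟩ := hp
      have h5 : 0 < 1 - p.2 := by linarith
      have := integrableOn_rpow_mul_exp_neg_mul_rpow (s := (1 - μ) - 1) (p := 1)
        (b := p.1 * (1 - p.2)) (by linarith) one_pos (by positivity)
      have hr : Integrable (fun r : ℝ => r ^ ((1 - μ) - 1) * rexp (-(p.1 * (1 - p.2) * r))) ρ := by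
        show IntegrableOn
          (fun r : ℝ => r ^ ((1 - μ) - 1) * rexp (-(p.1 * (1 - p.2) * r))) (Ioi 0)
        simpa only [Real.rpow_one, neg_mul] using this
      have hr' := hr.const_mul (p.1 * g p.1 * g (p.1 * p.2))
      exact hr'
    · refine (hKi.norm.const_mul (Real.Gamma (1 - μ))).congr ?_
      filter_upwards [hae] with p hp
      have hv := hval p hp
      obtain ⟨⟨h1, h2⟩, h3, h4⟩ := hp
      have h5 : 0 < 1 - p.2 := by linarith
      have : ∫ r, ‖Function.uncurry H (p, r)‖ ∂ρ
          = |g p.1| * |g (p.1 * p.2)| *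
            (p.1 * ∫ r, r ^ ((1 - μ) - 1) * rexp (-(p.1 * (1 - p.2) * r)) ∂ρ) := by
        rw [← integral_const_mul, ← integral_const_mul]
        refine setIntegral_congr_fun measurableSet_Ioi fun r hr => ?_
        have hr' : (0 : ℝ) < r := hr
        simp only [Function.uncurry, hH]
        rw [norm_mul, norm_mul, norm_mul, Real.norm_of_nonneg h1.le, Real.norm_eq_abs,
          Real.norm_eq_abs, Real.norm_of_nonneg (by positivity)]
        ring
      rw [this, hv]
      simp only [hK]
      rw [norm_mul, norm_mul, norm_mul, Real.norm_of_nonneg (by positivity : 0 ≤ p.1 ^ μ),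
        Real.norm_of_nonneg (by positivity : 0 ≤ (1 - p.2) ^ (μ - 1)), Real.norm_eq_abs,
        Real.norm_eq_abs]
      ring
  have e1 : ∫ p, ∫ r, H p r ∂ρ ∂(ν.prod ν) = Real.Gamma (1 - μ) * ∫ p, K p ∂(ν.prod ν) := by
    rw [← integral_const_mul]
    refine integral_congr_ae ?_
    filter_upwards [hae] with p hp
    simp only [hH, hK]
    rw [integral_const_mul]
    linear_combination g p.1 * g (p.1 * p.2) * hval p hp
  have e2 : 0 ≤ ∫ p, ∫ r, H p r ∂ρ ∂(ν.prod ν) := by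
    rw [integral_integral_swap hHi]
    have hgi : IntervalIntegrable g volume 0 1 := by
      rw [intervalIntegrable_iff_integrableOn_Ioo_of_le zero_le_one]
      refine ((hpow (c - 1) (by linarith)).const_mul M).mono' hgm.aestronglyMeasurable ?_
      exact (ae_restrict_iff' measurableSet_Ioo).2 (ae_of_all _ hM)
    refine integral_nonneg_of_ae ?_
    filter_upwards [hHi.prod_left_ae, ae_restrict_mem measurableSet_Ioi] with r hr hr0
    have hr0' : (0 : ℝ) < r := hr0
    have h := integral_exp_convolution_nonneg hg hgi hr0'.le
    rw [intervalIntegral.integral_of_le zero_le_one, integral_Ioc_eq_integral_Ioo] at h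
    have : ∫ p, H p r ∂(ν.prod ν) = r ^ ((1 - μ) - 1) *
        ∫ t in Ioo (0 : ℝ) 1, g t * rexp (-(r * t)) * ∫ s in (0 : ℝ)..t, g s * rexp (r * s) := by
      rw [integral_prod (fun p => H p r) hr, ← integral_const_mul]
      congr 1
      ext t
      rw [← integral_exp_convolution_eq, ← integral_const_mul]
      congr 1
      ext σ
      simp only [hH]
      ring
    rw [Pi.zero_apply, this]
    positivity
  rw [← integral_prod K hKi]
  rw [e1] at e2
  exact (mul_nonneg_iff_of_pos_left hΓ).1 e2

/-- The function `t ↦ t ^ (c - 1) * S(-x t ^ μ)`, where `S` is the Mittag-Leffler type series with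
parameters `μ` and `c`. -/
noncomputable def profile (q : ℕ → ℝ) (μ c x t : ℝ) : ℝ :=
  t ^ (c - 1) * series q μ c (-(x * t ^ μ))

lemma measurable_profile (hq : ∀ k, |q k| ≤ k + 1) (hμ : 0 < μ) (hc : 0 < c) :
    Measurable (profile q μ c x) := by
  have := (continuous_series hq hμ hc).measurable
  unfold profile
  fun_prop

lemma continuousOn_profile (hq : ∀ k, |q k| ≤ k + 1) (hμ : 0 < μ) (hc : 0 < c) :
    ContinuousOn (profile q μ c x) (Ioi 0) := by
  have hr : ∀ a : ℝ, ContinuousOn (fun t : ℝ => t ^ a) (Ioi 0) := fun a =>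
    continuousOn_id.rpow_const fun t ht => Or.inl (ne_of_gt ht)
  exact (hr _).mul
    ((continuous_series hq hμ hc).comp_continuousOn (continuousOn_const.mul (hr _)).neg)

lemma exists_abs_profile_le (hq : ∀ k, |q k| ≤ k + 1) (hμ : 0 < μ) (hc : 0 < c) (hx : 0 ≤ x) :
    ∃ M, ∀ t ∈ Ioo (0 : ℝ) 1, |profile q μ c x t| ≤ M * t ^ (c - 1) := by
  obtain ⟨M, hM⟩ := (isCompact_Icc (a := -x) (b := 0)).exists_bound_of_continuousOn
    (continuous_series hq hμ hc).continuousOn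
  refine ⟨M, fun t ht => ?_⟩
  have h1 : t ^ μ ≤ 1 := Real.rpow_le_one ht.1.le ht.2.le hμ.le
  have h2 : 0 < t ^ μ := Real.rpow_pos_of_pos ht.1 _
  have h3 := hM (-(x * t ^ μ)) ⟨by nlinarith, by nlinarith⟩
  have h4 : 0 < t ^ (c - 1) := Real.rpow_pos_of_pos ht.1 _
  rw [profile, abs_mul, abs_of_pos h4, mul_comm]
  gcongr
  exact h3

lemma integrableOn_sq_profile (hq : ∀ k, |q k| ≤ k + 1) (hμ : 0 < μ) (hc : 1 / 2 < c)
    (hx : 0 ≤ x) : IntegrableOn (fun t => profile q μ c x t ^ 2) (Ioo 0 1) := by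
  obtain ⟨M, hM⟩ := exists_abs_profile_le hq hμ (by linarith : 0 < c) hx
  have hb : IntegrableOn (fun t : ℝ => M ^ 2 * t ^ ((c - 1) + (c - 1))) (Ioo 0 1) := by
    rw [← intervalIntegrable_iff_integrableOn_Ioo_of_le zero_le_one]
    exact (intervalIntegral.intervalIntegrable_rpow' (by linarith)).const_mul _
  refine hb.mono' ((measurable_profile hq hμ (by linarith)).pow_const 2).aestronglyMeasurable
    ((ae_restrict_iff' measurableSet_Ioo).2 (ae_of_all _ fun t ht => ?_))
  rw [norm_pow, Real.norm_eq_abs, Real.rpow_add ht.1]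
  calc |profile q μ c x t| ^ 2 ≤ (M * t ^ (c - 1)) ^ 2 := by gcongr; exact hM t ht
    _ = _ := by ring

lemma integral_sq_profile_le (hq : ∀ k, |q k| ≤ k + 1) (hp : ∀ k, |p k| ≤ k + 1)
    (h0 : q 0 = p 0) (hs : ∀ k, q (k + 1) = p (k + 1) + q k) (hμ : 0 < μ) (hμ1 : μ < 1)
    (hc : 1 / 2 < c) (hx : 0 ≤ x) :
    ∫ t in Ioo (0 : ℝ) 1, profile q μ c x t ^ 2 ≤ ∫ t in Ioo (0 : ℝ) 1, profile p μ c x t ^ 2 := by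
  have hc0 : 0 < c := by linarith
  obtain ⟨M, hM⟩ := exists_abs_profile_le hq hμ hc0 hx
  have hpos := integral_rpow_kernel_nonneg hμ hμ1 hc (measurable_profile hq hμ hc0)
    (continuousOn_profile hq hμ hc0) hM
  have hΓ : 0 < Real.Gamma μ := Real.Gamma_pos_of_pos hμ
  have hq2 := integrableOn_sq_profile hq hμ hc hx
  have hp2 := integrableOn_sq_profile hp hμ hc hx
  have hqp : IntegrableOn (fun t => profile q μ c x t * profile p μ c x t) (Ioo 0 1) := by
    refine (hq2.add hp2).mono' ((measurable_profile hq hμ hc0).mul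
      (measurable_profile hp hμ hc0)).aestronglyMeasurable (ae_of_all _ fun t => ?_)
    rw [Real.norm_eq_abs, Pi.add_apply, abs_le]
    constructor <;> nlinarith [sq_nonneg (profile q μ c x t + profile p μ c x t),
      sq_nonneg (profile q μ c x t - profile p μ c x t)]
  have hinner : ∀ t ∈ Ioo (0 : ℝ) 1, x * ∫ σ in Ioo (0 : ℝ) 1,
      t ^ μ * profile q μ c x t * profile q μ c x (t * σ) * (1 - σ) ^ (μ - 1)
        = Real.Gamma μ *
          (profile q μ c x t * profile p μ c x t - profile q μ c x t ^ 2) := fun t ht => by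
    have e1 : ∫ σ in Ioo (0 : ℝ) 1,
        t ^ μ * profile q μ c x t * profile q μ c x (t * σ) * (1 - σ) ^ (μ - 1)
        = t ^ μ * profile q μ c x t * t ^ (c - 1) *
          (Real.Gamma μ * series q μ (c + μ) (-(x * t ^ μ))) := by
      rw [← integral_kernel_mul_series hq hμ hc0 hμ, ← integral_const_mul]
      refine setIntegral_congr_fun measurableSet_Ioo fun σ hσ => ?_
      rw [profile.eq_1 q μ c x (t * σ), Real.mul_rpow ht.1.le hσ.1.le,
        Real.mul_rpow ht.1.le hσ.1.le]
      ring_nf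
    have e2 := series_eq_add_mul (x := -(x * t ^ μ)) hq hp h0 hs hμ hc0
    have e3 : profile q μ c x t = profile p μ c x t
        - x * t ^ μ * t ^ (c - 1) * series q μ (c + μ) (-(x * t ^ μ)) := by
      rw [profile, profile, e2]; ring
    rw [e1]
    linear_combination (Real.Gamma μ * profile q μ c x t) * e3
  have h1 : 0 ≤ ∫ t in Ioo (0 : ℝ) 1,
      (profile q μ c x t * profile p μ c x t - profile q μ c x t ^ 2) := by
    have h := mul_nonneg hx hpos
    rw [← integral_const_mul, setIntegral_congr_fun measurableSet_Ioo hinner,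
      integral_const_mul] at h
    exact (mul_nonneg_iff_of_pos_left hΓ).1 h
  have h2 : ∫ t in Ioo (0 : ℝ) 1, (profile q μ c x t * profile p μ c x t - profile q μ c x t ^ 2)
      ≤ ∫ t in Ioo (0 : ℝ) 1, (1 / 2) * (profile p μ c x t ^ 2 - profile q μ c x t ^ 2) :=
    integral_mono (hqp.sub hq2) ((hp2.sub hq2).const_mul _) fun t => by
      nlinarith [sq_nonneg (profile q μ c x t - profile p μ c x t)]
  rw [integral_const_mul, integral_sub hp2 hq2] at h2
  linarith

lemma abs_series_le {M : ℝ} (hq : ∀ k, |q k| ≤ k + 1) (hμ : 0 < μ) (hc : 1 / 2 < c)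
    (hd : 1 / 2 < d) (hx : 0 ≤ x) (hM : ∫ t in Ioo (0 : ℝ) 1, profile q μ c x t ^ 2 ≤ M) :
    |series q μ (c + d) (-x)|
      ≤ ((∫ s in Ioo (0 : ℝ) 1, ((1 - s) ^ (d - 1)) ^ 2) + M) / Real.Gamma d := by
  have hΓ : 0 < Real.Gamma d := Real.Gamma_pos_of_pos (by linarith)
  have hw : IntegrableOn (fun s : ℝ => ((1 - s) ^ (d - 1)) ^ 2) (Ioo 0 1) := by
    refine (integrableOn_beta (c := 1) (d := (d - 1) + d) one_pos (by linarith)).congr ?_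
    refine (ae_restrict_iff' measurableSet_Ioo).2 (ae_of_all _ fun s hs => ?_)
    have : 0 < 1 - s := by linarith [hs.2]
    simp only [sub_self, Real.rpow_zero, mul_one]
    rw [add_sub_assoc, Real.rpow_add this, sq]
  have hg := integrableOn_sq_profile hq hμ hc hx
  have hrep := integral_kernel_mul_series (x := -x) hq hμ (by linarith : 0 < c)
    (by linarith : 0 < d)
  rw [le_div_iff₀ hΓ, ← abs_of_pos hΓ, ← abs_mul, mul_comm, ← hrep]
  calc |∫ s in Ioo (0 : ℝ) 1, (1 - s) ^ (d - 1) * (s ^ (c - 1) * series q μ c (-x * s ^ μ))|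
      ≤ ∫ s in Ioo (0 : ℝ) 1, (((1 - s) ^ (d - 1)) ^ 2 + profile q μ c x s ^ 2) := by
        have hi : Integrable (fun s : ℝ => ((1 - s) ^ (d - 1)) ^ 2 + profile q μ c x s ^ 2)
            (volume.restrict (Ioo 0 1)) := Integrable.add hw hg
        have hle : ∀ s : ℝ, ‖(1 - s) ^ (d - 1) * (s ^ (c - 1) * series q μ c (-x * s ^ μ))‖
            ≤ ((1 - s) ^ (d - 1)) ^ 2 + profile q μ c x s ^ 2 := fun s => by
          rw [Real.norm_eq_abs, neg_mul, ← profile, abs_le]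
          constructor <;> nlinarith [sq_nonneg ((1 - s) ^ (d - 1) + profile q μ c x s),
            sq_nonneg ((1 - s) ^ (d - 1) - profile q μ c x s)]
        exact norm_integral_le_of_norm_le hi (ae_of_all _ hle)
    _ ≤ _ := by
        rw [integral_add hw hg]
        gcongr

lemma abs_ite_zero_le (k : ℕ) : |(if k = 0 then 1 else 0 : ℝ)| ≤ k + 1 := by
  split_ifs <;> simp
  positivity

lemma abs_one_le_succ (k : ℕ) : |(1 : ℝ)| ≤ k + 1 := by simp

lemma abs_succ_le_succ (k : ℕ) : |(k : ℝ) + 1| ≤ k + 1 :=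
  (abs_of_nonneg (by positivity)).le

lemma series_ite_zero : series (fun k => if k = 0 then 1 else 0) μ b x = (Real.Gamma b)⁻¹ := by
  rw [series, tsum_eq_single 0 (fun k hk => by simp [hk])]
  simp

lemma series_one_eq (hμ : 0 < μ) (hb : 0 < b) :
    series (fun _ => 1) μ b x = (Real.Gamma b)⁻¹ + x * series (fun _ => 1) μ (b + μ) x := by
  rw [← series_ite_zero (μ := μ) (x := x)]
  exact series_eq_add_mul abs_one_le_succ abs_ite_zero_le (by simp) (by simp) hμ hb

lemma series_succ_eq (hμ : 0 < μ) (hb : 0 < b) :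
    series (fun k => (k : ℝ) + 1) μ b x
      = series (fun _ => 1) μ b x + x * series (fun k => (k : ℝ) + 1) μ (b + μ) x :=
  series_eq_add_mul abs_succ_le_succ abs_one_le_succ (by simp)
    (fun k => by push_cast; ring) hμ hb

lemma exists_integral_sq_profile_one_le (hμ : 0 < μ) (hμ1 : μ < 1) (hc : 1 / 2 < c) :
    ∃ M, ∀ x, 0 ≤ x → ∫ t in Ioo (0 : ℝ) 1, profile (fun _ => 1) μ c x t ^ 2 ≤ M := by
  refine ⟨∫ t in Ioo (0 : ℝ) 1, (t ^ (c - 1) * (Real.Gamma c)⁻¹) ^ 2, fun x hx =>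
    (integral_sq_profile_le (p := fun k => if k = 0 then 1 else 0)
    abs_one_le_succ abs_ite_zero_le (by simp) (by simp) hμ hμ1 hc hx).trans_eq ?_⟩
  simp only [profile, series_ite_zero]

lemma exists_abs_series_one_le (hμ : 0 < μ) (hμ1 : μ < 1) (hb : 1 < b) :
    ∃ M, ∀ x, 0 ≤ x → |series (fun _ => 1) μ b (-x)| ≤ M := by
  obtain ⟨M, hM⟩ := exists_integral_sq_profile_one_le hμ hμ1 (c := b / 2) (by linarith)
  refine ⟨((∫ s in Ioo (0 : ℝ) 1, ((1 - s) ^ (b / 2 - 1)) ^ 2) + M) / Real.Gamma (b / 2),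
    fun x hx => ?_⟩
  nth_rewrite 1 [← add_halves b]
  exact abs_series_le abs_one_le_succ hμ (by linarith) (by linarith) hx (hM x hx)

lemma exists_abs_series_succ_le (hμ : 0 < μ) (hμ1 : μ < 1) (hb : 1 < b) :
    ∃ M, ∀ x, 0 ≤ x → |series (fun k => (k : ℝ) + 1) μ b (-x)| ≤ M := by
  obtain ⟨M, hM⟩ := exists_integral_sq_profile_one_le hμ hμ1 (c := b / 2) (by linarith)
  refine ⟨((∫ s in Ioo (0 : ℝ) 1, ((1 - s) ^ (b / 2 - 1)) ^ 2) + M) / Real.Gamma (b / 2),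
    fun x hx => ?_⟩
  nth_rewrite 1 [← add_halves b]
  exact abs_series_le abs_succ_le_succ hμ (by linarith) (by linarith) hx
    ((integral_sq_profile_le abs_succ_le_succ abs_one_le_succ (by simp)
      (fun k => by push_cast; ring) hμ hμ1 (by linarith) hx).trans (hM x hx))

lemma integrableOn_kernel_mul_series (hq : ∀ k, |q k| ≤ k + 1) (hμ : 0 < μ) (hc : 0 < c)
    (hd : 0 < d) {e : ℝ} (he : 0 < e) {M : ℝ} (hM : ∀ x, 0 ≤ x → |series q μ c (-x)| ≤ M)
    (hx : 0 ≤ x) :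
    IntegrableOn (fun s : ℝ => (1 - s) ^ (d - 1) * (s ^ (e - 1) * series q μ c (-x * s ^ μ)))
      (Ioo 0 1) ∧
    |∫ s in Ioo (0 : ℝ) 1, (1 - s) ^ (d - 1) * (s ^ (e - 1) * series q μ c (-x * s ^ μ))|
      ≤ M * ∫ s in Ioo (0 : ℝ) 1, (1 - s) ^ (d - 1) * s ^ (e - 1) := by
  have hb := (integrableOn_beta he hd).const_mul M
  have hle : ∀ᵐ s ∂(volume.restrict (Ioo (0 : ℝ) 1)),
      ‖(1 - s) ^ (d - 1) * (s ^ (e - 1) * series q μ c (-x * s ^ μ))‖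
        ≤ M * ((1 - s) ^ (d - 1) * s ^ (e - 1)) := by
    refine (ae_restrict_iff' measurableSet_Ioo).2 (ae_of_all _ fun s hs => ?_)
    have h1 : 0 < 1 - s := by linarith [hs.2]
    have h2 : 0 < s := hs.1
    have h3 := hM (x * s ^ μ) (by positivity)
    rw [norm_mul, norm_mul, Real.norm_of_nonneg (by positivity : 0 ≤ (1 - s) ^ (d - 1)),
      Real.norm_of_nonneg (by positivity : 0 ≤ s ^ (e - 1)), Real.norm_eq_abs, neg_mul]
    calc _ ≤ (1 - s) ^ (d - 1) * (s ^ (e - 1) * M) := by gcongr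
      _ = _ := by ring
  constructor
  · refine hb.mono' ?_ hle
    have := (continuous_series hq hμ hc).measurable
    exact Measurable.aestronglyMeasurable (by fun_prop)
  · rw [← integral_const_mul]
    exact norm_integral_le_of_norm_le hb hle

lemma tendsto_series_neg_atTop (hq : ∀ k, |q k| ≤ k + 1) (hμ : 0 < μ) (hμ1 : μ < 1)
    (hbd : ∀ b, 1 < b → ∃ M, ∀ x, 0 ≤ x → |series q μ b (-x)| ≤ M)
    (hdec : ∀ b, 1 + μ < b → Tendsto (fun x => series q μ b (-x)) atTop (𝓝 0)) (hb : 1 < b) :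
    Tendsto (fun x => series q μ b (-x)) atTop (𝓝 0) := by
  obtain ⟨c, hc, hcb⟩ := exists_between hb
  obtain ⟨d, rfl⟩ : ∃ d, b = c + d := ⟨b - c, by ring⟩
  have hc0 : 0 < c := by linarith
  have hd : 0 < d := by linarith
  obtain ⟨M, hM⟩ := hbd c hc
  have hM0 : 0 ≤ M := (abs_nonneg _).trans (hM 0 le_rfl)
  set J : ℝ → ℕ → ℝ → ℝ := fun d n x =>
    ∫ s in Ioo (0 : ℝ) 1, (1 - s) ^ (d - 1) * (s ^ (c + n - 1) * series q μ c (-x * s ^ μ))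
    with hJ
  have hJ0 : ∀ d x, 0 < d → J d 0 x = Real.Gamma d * series q μ (c + d) (-x) := fun d x hd => by
    simp only [hJ, Nat.cast_zero, add_zero]
    exact integral_kernel_mul_series hq hμ hc0 hd
  have hrec : ∀ d n x, 0 < d → 0 ≤ x → J d n x = J d (n + 1) x + J (d + 1) n x :=
    fun d n x hd hx => by
    have i1 := (integrableOn_kernel_mul_series hq hμ hc0 hd (e := c + (n + 1 : ℕ))
      (by positivity) hM hx).1
    have i2 := (integrableOn_kernel_mul_series hq hμ hc0 (d := d + 1) (by linarith) (e := c + n)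
      (by positivity) hM hx).1
    simp only [hJ]
    rw [← integral_add i1 i2]
    refine setIntegral_congr_fun measurableSet_Ioo fun s hs => ?_
    have h1 : 0 < 1 - s := by linarith [hs.2]
    rw [show c + ((n + 1 : ℕ) : ℝ) - 1 = (c + n - 1) + 1 by push_cast; ring,
      show d + 1 - 1 = (d - 1) + 1 by ring, Real.rpow_add hs.1, Real.rpow_add h1,
      Real.rpow_one, Real.rpow_one]
    ring
  have hlarge : ∀ n : ℕ, ∀ d, μ < d → Tendsto (J d n) atTop (𝓝 0) := by
    intro n
    induction n with
    | zero =>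
      intro d hd
      have h := (hdec (c + d) (by linarith)).const_mul (Real.Gamma d)
      rw [mul_zero] at h
      exact h.congr fun x => (hJ0 d x (hμ.trans hd)).symm
    | succ n ih =>
      intro d hd
      have h := (ih d hd).sub (ih (d + 1) (by linarith))
      rw [sub_zero] at h
      refine h.congr' ?_
      filter_upwards [eventually_ge_atTop 0] with x hx
      rw [hrec d n x (hμ.trans hd) hx]
      ring
  have hdiff : ∀ n : ℕ, Tendsto (fun x => J d 0 x - J d n x) atTop (𝓝 0) := by
    intro n
    induction n with
    | zero => simp
    | succ n ih =>
      have h := ih.add (hlarge n (d + 1) (by linarith))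
      rw [add_zero] at h
      refine h.congr' ?_
      filter_upwards [eventually_ge_atTop 0] with x hx
      rw [hrec d n x hd hx]
      ring
  have hbeta : Tendsto (fun n : ℕ => M * ∫ s in Ioo (0 : ℝ) 1,
      (1 - s) ^ (d - 1) * s ^ (c + n - 1)) atTop (𝓝 0) := by
    have h : Tendsto (fun n : ℕ => ∫ s in Ioo (0 : ℝ) 1,
        (1 - s) ^ (d - 1) * s ^ (c + n - 1)) atTop (𝓝 (∫ s in Ioo (0 : ℝ) 1, (0 : ℝ))) := by
      refine tendsto_integral_of_dominated_convergence
        (fun s => (1 - s) ^ (d - 1) * s ^ (c - 1))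
        (fun n => (integrableOn_beta (by positivity) hd).aestronglyMeasurable)
        (integrableOn_beta hc0 hd) (fun n => ?_) ?_
      · refine (ae_restrict_iff' measurableSet_Ioo).2 (ae_of_all _ fun s hs => ?_)
        have h1 : 0 < 1 - s := by linarith [hs.2]
        have h2 : 0 < s := hs.1
        rw [Real.norm_of_nonneg (by positivity)]
        have := Real.rpow_le_rpow_of_exponent_ge h2 hs.2.le
          (by linarith [(Nat.cast_nonneg n : (0 : ℝ) ≤ n)] : c - 1 ≤ c + n - 1)
        gcongr
      · refine (ae_restrict_iff' measurableSet_Ioo).2 (ae_of_all _ fun s hs => ?_)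
        have h := (tendsto_pow_atTop_nhds_zero_of_lt_one hs.1.le hs.2).const_mul
          ((1 - s) ^ (d - 1) * s ^ (c - 1))
        rw [mul_zero] at h
        refine h.congr fun n => ?_
        rw [show c + (n : ℝ) - 1 = (c - 1) + n by ring, Real.rpow_add hs.1, Real.rpow_natCast]
        ring
    rw [integral_zero] at h
    simpa using h.const_mul M
  have hJlim : Tendsto (J d 0) atTop (𝓝 0) := by
    rw [Metric.tendsto_nhds]
    intro ε hε
    obtain ⟨n, hn⟩ := (hbeta.eventually_lt_const (half_pos hε)).exists
    filter_upwards [(Metric.tendsto_nhds.1 (hdiff n)) _ (half_pos hε), eventually_ge_atTop 0]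
      with x h1 hx
    have h2 := (integrableOn_kernel_mul_series hq hμ hc0 hd (e := c + n)
      (by positivity) hM hx).2
    rw [Real.dist_0_eq_abs] at h1 ⊢
    calc |J d 0 x| = |(J d 0 x - J d n x) + J d n x| := by ring_nf
      _ ≤ |J d 0 x - J d n x| + |J d n x| := abs_add_le _ _
      _ < ε / 2 + ε / 2 := add_lt_add h1 (h2.trans_lt hn)
      _ = ε := add_halves ε
  have hΓ := (Real.Gamma_pos_of_pos hd).ne'
  have h := hJlim.const_mul (Real.Gamma d)⁻¹
  rw [mul_zero] at h
  refine h.congr fun x => ?_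
  rw [hJ0 d x hd, inv_mul_cancel_left₀ hΓ]

lemma tendsto_of_abs_mul_le {f : ℝ → ℝ} {M : ℝ} (h : ∀ x, 0 ≤ x → |x * f x| ≤ M) :
    Tendsto f atTop (𝓝 0) := by
  refine squeeze_zero_norm' (a := fun x => M * x⁻¹) ?_ ?_
  · filter_upwards [eventually_gt_atTop 0] with x hx
    have := h x hx.le
    rw [abs_mul, abs_of_pos hx] at this
    rw [Real.norm_eq_abs, ← div_eq_mul_inv, le_div_iff₀ hx]
    linarith
  · simpa using tendsto_inv_atTop_zero.const_mul M

lemma tendsto_series_one (hμ : 0 < μ) (hμ1 : μ < 1) (hb : 1 < b) :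
    Tendsto (fun x => series (fun _ => 1) μ b (-x)) atTop (𝓝 0) := by
  refine tendsto_series_neg_atTop abs_one_le_succ hμ hμ1
    (fun b hb => exists_abs_series_one_le hμ hμ1 hb) (fun b hb => ?_) hb
  obtain ⟨M, hM⟩ := exists_abs_series_one_le hμ hμ1 (b := b - μ) (by linarith)
  refine tendsto_of_abs_mul_le (M := |(Real.Gamma (b - μ))⁻¹| + M) fun x hx => ?_
  have h := series_one_eq (x := -x) hμ (by linarith : 0 < b - μ)
  rw [sub_add_cancel] at h
  rw [show x * series (fun _ => 1) μ b (-x)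
    = (Real.Gamma (b - μ))⁻¹ - series (fun _ => 1) μ (b - μ) (-x) by linarith]
  exact (abs_sub _ _).trans (by gcongr; exact hM x hx)

lemma tendsto_series_succ (hμ : 0 < μ) (hμ1 : μ < 1) (hb : 1 < b) :
    Tendsto (fun x => series (fun k => (k : ℝ) + 1) μ b (-x)) atTop (𝓝 0) := by
  refine tendsto_series_neg_atTop abs_succ_le_succ hμ hμ1
    (fun b hb => exists_abs_series_succ_le hμ hμ1 hb) (fun b hb => ?_) hb
  obtain ⟨M, hM⟩ := exists_abs_series_one_le hμ hμ1 (b := b - μ) (by linarith)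
  obtain ⟨M', hM'⟩ := exists_abs_series_succ_le hμ hμ1 (b := b - μ) (by linarith)
  refine tendsto_of_abs_mul_le (M := M + M') fun x hx => ?_
  have h := series_succ_eq (x := -x) hμ (by linarith : 0 < b - μ)
  rw [sub_add_cancel] at h
  rw [show x * series (fun k => (k : ℝ) + 1) μ b (-x) = series (fun _ => 1) μ (b - μ) (-x)
    - series (fun k => (k : ℝ) + 1) μ (b - μ) (-x) by linarith]
  exact (abs_sub _ _).trans (add_le_add (hM x hx) (hM' x hx))

lemma tendsto_mul_series_one (hμ : 0 < μ) (hμ1 : μ < 1) (hb : 1 < b) :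
    Tendsto (fun x => x * series (fun _ => 1) μ (b + μ) (-x)) atTop
      (𝓝 (Real.Gamma b)⁻¹) := by
  have h := (tendsto_series_one hμ hμ1 hb).const_sub (Real.Gamma b)⁻¹
  rw [sub_zero] at h
  refine h.congr fun x => ?_
  rw [series_one_eq hμ (by linarith)]
  ring

lemma tendsto_sq_mul_series_succ (hμ : 0 < μ) (hμ1 : μ < 1) (hb : 1 < b) :
    Tendsto (fun x => x ^ 2 * series (fun k => (k : ℝ) + 1) μ (b + μ + μ) (-x)) atTop
      (𝓝 (Real.Gamma b)⁻¹) := by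
  have h := (tendsto_mul_series_one hμ hμ1 hb).sub
    ((tendsto_series_one hμ hμ1 hb).sub (tendsto_series_succ hμ hμ1 hb))
  rw [sub_zero, sub_zero] at h
  refine h.congr fun x => ?_
  have h1 := series_succ_eq (x := -x) hμ (by linarith : 0 < b)
  have h2 := series_succ_eq (x := -x) hμ (by linarith : 0 < b + μ)
  linear_combination h1 - x * h2

lemma summable_term_mul_term (hμ : 0 < μ) (hb : 0 < b) :
    Summable fun z : ℕ × ℕ => x ^ (z.1 + z.2) / Real.Gamma (((z.1 + z.2 : ℕ) : ℝ) * μ + b) := by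
  rw [← Finset.HasAntidiagonal.sigmaAntidiagonalEquivProd.summable_iff]
  refine Summable.of_norm ?_
  rw [summable_sigma_of_nonneg fun _ => norm_nonneg _]
  refine ⟨fun n => (hasSum_fintype _).summable, ?_⟩
  refine (summable_abs_term (x := x) abs_succ_le_succ hμ hb).congr fun n => ?_
  rw [← abs_term (q := fun k : ℕ => (k : ℝ) + 1) hμ hb, tsum_fintype]
  have : ∀ z : Finset.HasAntidiagonal.antidiagonal n, ‖((fun z : ℕ × ℕ =>
      x ^ (z.1 + z.2) / Real.Gamma (((z.1 + z.2 : ℕ) : ℝ) * μ + b)) ∘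
      Finset.HasAntidiagonal.sigmaAntidiagonalEquivProd) ⟨n, z⟩‖ = |x ^ n / Real.Gamma ((n : ℝ) * μ + b)| := by
    intro z
    have hz := Finset.HasAntidiagonal.mem_antidiagonal.1 z.2
    simp only [Function.comp, Finset.HasAntidiagonal.sigmaAntidiagonalEquivProd_apply, hz, Real.norm_eq_abs]
  rw [Finset.sum_congr rfl fun z _ => this z]
  simp only [Finset.sum_const, Finset.card_univ, Fintype.card_coe, Finset.Nat.card_antidiagonal,
    nsmul_eq_mul]
  rw [mul_div_assoc, abs_mul, abs_of_nonneg (by positivity : (0 : ℝ) ≤ (n : ℝ) + 1)]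
  push_cast
  rfl

lemma tsum_term_mul_term (hμ : 0 < μ) (hb : 0 < b) :
    ∑' z : ℕ × ℕ, x ^ (z.1 + z.2) / Real.Gamma (((z.1 + z.2 : ℕ) : ℝ) * μ + b)
      = series (fun k => (k : ℝ) + 1) μ b x := by
  have hs := summable_term_mul_term (x := x) hμ hb
  rw [← Finset.HasAntidiagonal.sigmaAntidiagonalEquivProd.tsum_eq]
  rw [← Finset.HasAntidiagonal.sigmaAntidiagonalEquivProd.summable_iff] at hs
  refine (Summable.tsum_sigma' (fun n => (hasSum_fintype _).summable) hs).trans ?_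
  rw [series]
  congr 1
  ext n
  simp only [Function.comp]
  rw [tsum_fintype]
  have : ∀ z : Finset.HasAntidiagonal.antidiagonal n, x ^ ((Finset.HasAntidiagonal.sigmaAntidiagonalEquivProd ⟨n, z⟩).1
      + (Finset.HasAntidiagonal.sigmaAntidiagonalEquivProd ⟨n, z⟩).2) / Real.Gamma
      ((((Finset.HasAntidiagonal.sigmaAntidiagonalEquivProd ⟨n, z⟩).1
      + (Finset.HasAntidiagonal.sigmaAntidiagonalEquivProd ⟨n, z⟩).2 : ℕ) : ℝ) * μ + b)
      = x ^ n / Real.Gamma ((n : ℝ) * μ + b) := by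
    intro z
    have hz := Finset.HasAntidiagonal.mem_antidiagonal.1 z.2
    simp only [Finset.HasAntidiagonal.sigmaAntidiagonalEquivProd_apply, hz]
  rw [Finset.sum_congr rfl fun z _ => this z]
  simp only [Finset.sum_const, Finset.card_univ, Fintype.card_coe, Finset.Nat.card_antidiagonal,
    nsmul_eq_mul]
  push_cast
  ring

lemma integral_series_one_convolution (hμ : 0 < μ) (hc : 0 < c) (hd : 0 < d) :
    ∫ s in Ioo (0 : ℝ) 1, ((1 - s) ^ (d - 1) * series (fun _ => 1) μ d (x * (1 - s) ^ μ)) *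
        (s ^ (c - 1) * series (fun _ => 1) μ c (x * s ^ μ))
      = series (fun k => (k : ℝ) + 1) μ (c + d) x := by
  set A : ℕ → ℝ → ℝ := fun j y =>
    1 * (x * y ^ μ) ^ j / Real.Gamma ((j : ℝ) * μ + d) with hA
  set B : ℕ → ℝ → ℝ := fun k y =>
    1 * (x * y ^ μ) ^ k / Real.Gamma ((k : ℝ) * μ + c) with hB
  set F : ℕ × ℕ → ℝ → ℝ := fun z s =>
    (x ^ (z.1 + z.2) / (Real.Gamma ((z.1 : ℝ) * μ + d) * Real.Gamma ((z.2 : ℝ) * μ + c))) *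
      ((1 - s) ^ ((z.1 : ℝ) * μ + d - 1) * s ^ ((z.2 : ℝ) * μ + c - 1)) with hF
  have hcancel : ∀ (a : ℝ) (z : ℕ × ℕ),
      a / (Real.Gamma ((z.1 : ℝ) * μ + d) * Real.Gamma ((z.2 : ℝ) * μ + c)) *
      (Real.Gamma ((z.1 : ℝ) * μ + d) * Real.Gamma ((z.2 : ℝ) * μ + c) /
        Real.Gamma (((z.2 : ℝ) * μ + c) + ((z.1 : ℝ) * μ + d)))
      = a / Real.Gamma (((z.1 + z.2 : ℕ) : ℝ) * μ + (c + d)) := fun a z => by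
    have h1 := (Real.Gamma_pos_of_pos (arg_pos hμ hd z.1)).ne'
    have h2 := (Real.Gamma_pos_of_pos (arg_pos hμ hc z.2)).ne'
    rw [show ((z.2 : ℝ) * μ + c) + ((z.1 : ℝ) * μ + d)
      = ((z.1 + z.2 : ℕ) : ℝ) * μ + (c + d) by push_cast; ring]
    field_simp
  have hint : ∀ z, Integrable (F z) (volume.restrict (Ioo 0 1)) := fun z =>
    (integrableOn_beta (arg_pos hμ hc z.2) (arg_pos hμ hd z.1)).const_mul _
  have hval : ∀ z, ∫ s in Ioo (0 : ℝ) 1, F z s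
      = x ^ (z.1 + z.2) / Real.Gamma (((z.1 + z.2 : ℕ) : ℝ) * μ + (c + d)) := fun z => by
    simp only [hF]
    rw [integral_const_mul, integral_beta (arg_pos hμ hc z.2) (arg_pos hμ hd z.1), hcancel]
  have hnorm : ∀ z, ∫ s in Ioo (0 : ℝ) 1, ‖F z s‖
      = |x| ^ (z.1 + z.2) / Real.Gamma (((z.1 + z.2 : ℕ) : ℝ) * μ + (c + d)) := fun z => by
    have h1 := Real.Gamma_pos_of_pos (arg_pos hμ hd z.1)
    have h2 := Real.Gamma_pos_of_pos (arg_pos hμ hc z.2)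
    rw [← hcancel, ← integral_beta (arg_pos hμ hc z.2) (arg_pos hμ hd z.1),
      ← integral_const_mul]
    refine setIntegral_congr_fun measurableSet_Ioo fun s hs => ?_
    have h3 : 0 < 1 - s := by linarith [hs.2]
    have h4 := hs.1
    simp only [hF]
    rw [norm_mul, norm_div, norm_pow, Real.norm_eq_abs x, Real.norm_of_nonneg (by positivity),
      Real.norm_of_nonneg (by positivity)]
  have hsum := hasSum_integral_of_summable_integral_norm hint
    (by simp only [hnorm]; exact summable_term_mul_term hμ (by positivity))
  simp only [hval] at hsum
  rw [← tsum_term_mul_term hμ (by positivity), hsum.tsum_eq]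
  refine setIntegral_congr_fun measurableSet_Ioo fun s hs => ?_
  have h1 : 0 < 1 - s := by linarith [hs.2]
  have h2 := hs.1
  have hprod := tsum_mul_tsum_of_summable_norm
    (summable_term (x := x * (1 - s) ^ μ) abs_one_le_succ hμ hd).norm
    (summable_term (x := x * s ^ μ) abs_one_le_succ hμ hc).norm
  simp only [series]
  rw [mul_mul_mul_comm, hprod, ← tsum_mul_left]
  congr 1
  ext z
  simp only [hF]
  rw [mul_pow, mul_pow, ← Real.rpow_natCast (s ^ μ), ← Real.rpow_natCast ((1 - s) ^ μ),
    ← Real.rpow_mul h1.le, ← Real.rpow_mul h2.le,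
    show (z.1 : ℝ) * μ + d - 1 = (d - 1) + μ * z.1 by ring,
    show (z.2 : ℝ) * μ + c - 1 = (c - 1) + μ * z.2 by ring,
    Real.rpow_add h1, Real.rpow_add h2, pow_add]
  ring

lemma ML_eq_series : ML μ b x = series (fun _ => 1) μ b x := by
  simp only [ML, series, one_mul]

lemma integral_Ufun_mul_ufun {a1 a2 C1 C2 t : ℝ} (ha1 : 0 < a1) (ha12 : a2 < a1) (ht : 0 < t) :
    ∫ τ in (0 : ℝ)..t, (Ufun a1 a2 C1 C2 (t - τ) + Ufun a1 a2 C1 C2 (t - τ)) * ufun a1 a2 C1 C2 τ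
      = 2 * t ^ (2 * a1) / C1 ^ 2 *
        series (fun k => (k : ℝ) + 1) (a1 - a2) (a1 + (a1 + 1)) (-C2 * t ^ (a1 - a2) / C1) := by
  have h := intervalIntegral.mul_integral_comp_mul_left (a := 0) (b := 1) (c := t) (f := fun τ =>
    (Ufun a1 a2 C1 C2 (t - τ) + Ufun a1 a2 C1 C2 (t - τ)) * ufun a1 a2 C1 C2 τ)
  rw [mul_zero, mul_one] at h
  rw [← h, intervalIntegral.integral_of_le zero_le_one, integral_Ioc_eq_integral_Ioo,
    ← integral_series_one_convolution (by linarith : 0 < a1 - a2) ha1 (by linarith : 0 < a1 + 1),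
    ← integral_const_mul, ← integral_const_mul]
  refine setIntegral_congr_fun measurableSet_Ioo fun s hs => ?_
  have h1 : 0 < 1 - s := by linarith [hs.2]
  have e1 : t ^ (2 * a1) = t * t ^ a1 * t ^ (a1 - 1) := by
    rw [two_mul, Real.rpow_add ht, Real.rpow_sub_one ht.ne']
    field_simp
  simp only [Ufun, ufun, ML_eq_series]
  rw [show t - t * s = t * (1 - s) by ring, Real.mul_rpow ht.le h1.le, Real.mul_rpow ht.le h1.le,
    Real.mul_rpow ht.le hs.1.le, Real.mul_rpow ht.le hs.1.le, e1, add_sub_cancel_right,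
    show -C2 * (t ^ (a1 - a2) * (1 - s) ^ (a1 - a2)) / C1
      = -C2 * t ^ (a1 - a2) / C1 * (1 - s) ^ (a1 - a2) by ring,
    show -C2 * (t ^ (a1 - a2) * s ^ (a1 - a2)) / C1
      = -C2 * t ^ (a1 - a2) / C1 * s ^ (a1 - a2) by ring]
  ring

end MittagLeffler

open MittagLeffler in
/-- Proposition 3.2: `t^{-2α₂} Var_Y(t) → (1/C₂²)(2/Γ(2α₂+1) - 1/Γ(α₂+1)²)` as `t → ∞`. -/
theorem stmt_6 (a1 a2 C1 C2 : ℝ) (ha2 : 0 < a2) (ha12 : a2 < a1) (ha1 : a1 < 1)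
    (hC1 : 0 < C1) (hC2 : 0 < C2) (hC : C1 + C2 = 1) :
    Tendsto (fun t : ℝ => t ^ (-(2 * a2)) * VarY a1 a2 C1 C2 t) atTop
      (𝓝 (1 / C2 ^ 2
        * (2 / Real.Gamma (2 * a2 + 1) - 1 / Real.Gamma (a2 + 1) ^ 2))) := by
  have hμ : 0 < a1 - a2 := by linarith
  have hμ1 : a1 - a2 < 1 := by linarith
  have hx : Tendsto (fun t : ℝ => C2 * t ^ (a1 - a2) / C1) atTop atTop :=
    ((tendsto_rpow_atTop hμ).const_mul_atTop hC2).atTop_div_const hC1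
  have hU := (tendsto_mul_series_one hμ hμ1 (by linarith : 1 < a2 + 1)).comp hx
  have hV := (tendsto_sq_mul_series_succ hμ hμ1 (by linarith : 1 < 2 * a2 + 1)).comp hx
  have h := ((hV.const_mul 2).sub (hU.pow 2)).const_mul (1 / C2 ^ 2)
  rw [inv_pow, ← div_eq_mul_inv, ← one_div] at h
  refine h.congr' ?_
  filter_upwards [eventually_gt_atTop 0] with t ht
  have e1 : t ^ (2 * a1) = t ^ (a1 - a2) * t ^ (a1 - a2) * t ^ a2 * t ^ a2 := by
    simp only [← Real.rpow_add ht]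
    ring_nf
  have e2 : t ^ a1 = t ^ (a1 - a2) * t ^ a2 := by
    simp only [← Real.rpow_add ht]
    ring_nf
  have e3 : t ^ (-(2 * a2)) = (t ^ a2 * t ^ a2)⁻¹ := by
    rw [Real.rpow_neg ht.le, two_mul, Real.rpow_add ht]
  have hp : 0 < t ^ a2 := Real.rpow_pos_of_pos ht _
  rw [VarY, CovY, min_self, integral_Ufun_mul_ufun (by linarith) ha12 ht, Ufun, ML_eq_series, e1,
    e2, e3, show a1 + (a1 + 1) = 2 * a2 + 1 + (a1 - a2) + (a1 - a2) by ring,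
    show a1 + 1 = a2 + 1 + (a1 - a2) by ring,
    show -C2 * t ^ (a1 - a2) / C1 = -(C2 * t ^ (a1 - a2) / C1) by ring]
  simp only [Function.comp]
  generalize series _ _ _ _ = E2
  generalize series _ _ _ _ = E1
  field_simp
end
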